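/- For q ∈ ℂ, q ≠ 0, the specialized mirabolic Hecke algebra ℛ_n(q) = R_n(ℂ, q) is a semisimple ring if and only if [n]_q! ≠ 0, where [n]_q! = ∏_{k=1}^{n} (1 + q + ⋯ + q^{k−1}). -/

import Mathlib

noncomputable section

/-- The relations of Solomon's presentation of the mirabolic Hecke algebra `R_n(K,q)`,
on generators `T_0, T_1, …, T_{n-1}` (indexed by `Fin n`). -/
inductive SolomonRel (K : Type) [Field K] (q : K) (n : ℕ) :
    FreeAlgebra K (Fin n) → FreeAlgebra K (Fin n) → Prop
  | quad0 (i : Fin n) (hi : i.val = 0) :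
      SolomonRel K q n (FreeAlgebra.ι K i * FreeAlgebra.ι K i)
        ((q - 2) • FreeAlgebra.ι K i + (q - 1) • (1 : FreeAlgebra K (Fin n)))
  | quad (i : Fin n) (hi : 1 ≤ i.val) :
      SolomonRel K q n (FreeAlgebra.ι K i * FreeAlgebra.ι K i)
        ((q - 1) • FreeAlgebra.ι K i + q • (1 : FreeAlgebra K (Fin n)))
  | braid (i j : Fin n) (hi : 1 ≤ i.val) (hij : i.val + 1 = j.val) :
      SolomonRel K q n (FreeAlgebra.ι K i * FreeAlgebra.ι K j * FreeAlgebra.ι K i)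
        (FreeAlgebra.ι K j * FreeAlgebra.ι K i * FreeAlgebra.ι K j)
  | rel4 (i j : Fin n) (hi : i.val = 0) (hj : j.val = 1) :
      SolomonRel K q n
        (FreeAlgebra.ι K i * FreeAlgebra.ι K j * FreeAlgebra.ι K i * FreeAlgebra.ι K j)
        ((q - 1) • (FreeAlgebra.ι K j * FreeAlgebra.ι K i * FreeAlgebra.ι K j +
            FreeAlgebra.ι K j * FreeAlgebra.ι K i) -
          FreeAlgebra.ι K i * FreeAlgebra.ι K j * FreeAlgebra.ι K i)
  | rel5 (i j : Fin n) (hi : i.val = 0) (hj : j.val = 1) :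
      SolomonRel K q n
        (FreeAlgebra.ι K j * FreeAlgebra.ι K i * FreeAlgebra.ι K j * FreeAlgebra.ι K i)
        ((q - 1) • (FreeAlgebra.ι K j * FreeAlgebra.ι K i * FreeAlgebra.ι K j +
            FreeAlgebra.ι K i * FreeAlgebra.ι K j) -
          FreeAlgebra.ι K i * FreeAlgebra.ι K j * FreeAlgebra.ι K i)
  | comm (i j : Fin n) (hij : i.val + 2 ≤ j.val ∨ j.val + 2 ≤ i.val) :
      SolomonRel K q n (FreeAlgebra.ι K i * FreeAlgebra.ι K j)
        (FreeAlgebra.ι K j * FreeAlgebra.ι K i)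

/-- The mirabolic Hecke algebra `R_n(K,q)`, presented by Solomon's relations. -/
abbrev MirabolicHecke (K : Type) [Field K] (q : K) (n : ℕ) : Type :=
  RingQuot (SolomonRel K q n)

/-- The generator `T_i` of the mirabolic Hecke algebra. -/
def MirabolicHecke.T {K : Type} [Field K] {q : K} {n : ℕ} (i : Fin n) :
    MirabolicHecke K q n :=
  RingQuot.mkAlgHom K (SolomonRel K q n) (FreeAlgebra.ι K i)

/-- The relations of the Hecke algebra of type `A_{n-1}` for `T 1, …, T (n - 1)`. -/
structure HeckeRel {A : Type*} [Ring A] [Algebra ℂ A] (q : ℂ) (n : ℕ) (T : ℕ → A) : Prop where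
  quad : ∀ i, 1 ≤ i → i < n → T i * T i = (q - 1) • T i + q • (1 : A)
  braid : ∀ i, 1 ≤ i → i + 1 < n → T i * T (i + 1) * T i = T (i + 1) * T i * T (i + 1)
  comm : ∀ i j, 1 ≤ i → i + 2 ≤ j → j < n → T i * T j = T j * T i

/-- The type `B` relations between `p` and the Hecke generators. -/
structure TypeBRel {A : Type*} [Ring A] (n : ℕ) (T : ℕ → A) (p : A) : Prop where
  comm : ∀ i, 2 ≤ i → i < n → Commute (T i) p
  braid : 1 < n → p * T 1 * p * T 1 = T 1 * p * T 1 * p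

theorem TypeBRel.one {A : Type*} [Ring A] {n : ℕ} {T : ℕ → A} : TypeBRel n T (1 : A) :=
  ⟨fun _ _ _ => Commute.one_right _, by simp⟩

section Hecke

variable {A : Type*} [Ring A] [Algebra ℂ A] {q : ℂ} {n : ℕ} {T : ℕ → A}

theorem HeckeRel.mono (h : HeckeRel q n T) {m : ℕ} (hm : m ≤ n) : HeckeRel q m T :=
  ⟨fun i h1 h2 => h.quad i h1 (by omega), fun i h1 h2 => h.braid i h1 (by omega),
    fun i j h1 h2 h3 => h.comm i j h1 h2 (by omega)⟩

theorem HeckeRel.shift (h : HeckeRel q (n + 1) T) : HeckeRel q n (fun i => T (i + 1)) :=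
  ⟨fun i h1 h2 => h.quad _ (by omega) (by omega), fun i h1 h2 => h.braid _ (by omega) (by omega),
    fun i j h1 h2 h3 => h.comm _ _ (by omega) (by omega) (by omega)⟩

theorem HeckeRel.map {B : Type*} [Ring B] [Algebra ℂ B] (h : HeckeRel q n T) (f : A →ₐ[ℂ] B) :
    HeckeRel q n (fun i => f (T i)) := by
  refine ⟨fun i h1 h2 => ?_, fun i h1 h2 => ?_, fun i j h1 h2 h3 => ?_⟩
  · simpa using congrArg f (h.quad i h1 h2)
  · simpa using congrArg f (h.braid i h1 h2)
  · simpa using congrArg f (h.comm i j h1 h2 h3)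

/-- The relative trace from the Hecke algebra of type `A_{k-2}` to that of type `A_{k-1}`:
`f ↦ ∑_j q^{-(k-j)} T_j ⋯ T_{k-1} f T_{k-1} ⋯ T_j`. -/
def relTrace (q : ℂ) (T : ℕ → A) : ℕ → A →ₗ[ℂ] A
  | 0 => 0
  | k + 1 => LinearMap.id +
      relTrace q T k ∘ₗ (q⁻¹ • (LinearMap.mulLeft ℂ (T k) ∘ₗ LinearMap.mulRight ℂ (T k)))

theorem relTrace_zero (f : A) : relTrace q T 0 f = 0 := rfl

theorem relTrace_succ (k : ℕ) (f : A) :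
    relTrace q T (k + 1) f = f + relTrace q T k (q⁻¹ • (T k * f * T k)) := by
  simp [relTrace, mul_assoc]

theorem relTrace_mul_right (k : ℕ) (f y : A) (hy : ∀ i, 1 ≤ i → i < k → Commute (T i) y) :
    relTrace q T k (f * y) = relTrace q T k f * y := by
  induction k generalizing f with
  | zero => simp [relTrace_zero]
  | succ k ih =>
    rcases Nat.eq_zero_or_pos k with rfl | hk
    · simp [relTrace_succ, relTrace_zero]
    rw [relTrace_succ, relTrace_succ, add_mul, ← ih _ fun i h1 h2 => hy i h1 (by omega)]
    congr 2
    rw [smul_mul_assoc, mul_assoc, mul_assoc f, ← (hy k hk (by omega)).eq]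
    simp only [mul_assoc]

theorem relTrace_mul_left (k : ℕ) (f y : A) (hy : ∀ i, 1 ≤ i → i < k → Commute (T i) y) :
    relTrace q T k (y * f) = y * relTrace q T k f := by
  induction k generalizing f with
  | zero => simp [relTrace_zero]
  | succ k ih =>
    rcases Nat.eq_zero_or_pos k with rfl | hk
    · simp [relTrace_succ, relTrace_zero]
    rw [relTrace_succ, relTrace_succ, mul_add, ← ih _ fun i h1 h2 => hy i h1 (by omega)]
    congr 2
    rw [mul_smul_comm, ← mul_assoc, (hy k hk (by omega)).eq]
    simp only [mul_assoc]

theorem relTrace_commute_of_commute (k : ℕ) (f y : A)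
    (hy : ∀ i, 1 ≤ i → i < k → Commute (T i) y) (hf : Commute f y) :
    Commute (relTrace q T k f) y := by
  rw [Commute, SemiconjBy, ← relTrace_mul_right k f y hy, ← relTrace_mul_left k f y hy, hf.eq]

theorem HeckeRel.commute (h : HeckeRel q n T) {i j : ℕ} (hi : 1 ≤ i) (hj : i + 2 ≤ j)
    (hn : j < n) : Commute (T i) (T j) := h.comm i j hi hj hn

theorem HeckeRel.commute_conj (h : HeckeRel q n T) (hq : q ≠ 0) {k : ℕ} (hk : 1 ≤ k) (hn : k < n)
    (f : A) : Commute (T k) (f + q⁻¹ • (T k * f * T k)) := by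
  have e1 : T k * (T k * f * T k) = (q - 1) • (T k * f * T k) + q • (f * T k) := by
    rw [mul_assoc, ← mul_assoc, h.quad k hk hn]
    simp only [add_mul, smul_mul_assoc, one_mul]
  have e2 : T k * f * T k * T k = (q - 1) • (T k * f * T k) + q • (T k * f) := by
    rw [mul_assoc, h.quad k hk hn]
    simp only [mul_add, mul_smul_comm, mul_one]
  rw [Commute, SemiconjBy, mul_add, add_mul, mul_smul_comm, smul_mul_assoc, e1, e2, smul_add,
    smul_add, smul_smul q⁻¹ q, smul_smul q⁻¹ q, inv_mul_cancel₀ hq, one_smul, one_smul]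
  abel

theorem HeckeRel.commute_braid_conj (h : HeckeRel q n T) {k : ℕ} (hk : 1 ≤ k) (hn : k + 1 < n)
    {f : A} (hf : Commute (T k) f) :
    Commute (T (k + 1)) (T k * (T (k + 1) * f * T (k + 1)) * T k) := by
  have hb := h.braid k hk hn
  rw [Commute, SemiconjBy]
  calc T (k + 1) * (T k * (T (k + 1) * f * T (k + 1)) * T k)
      = (T (k + 1) * T k * T (k + 1)) * f * T (k + 1) * T k := by simp only [mul_assoc]
    _ = T k * T (k + 1) * (T k * f) * T (k + 1) * T k := by rw [← hb]; simp only [mul_assoc]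
    _ = T k * T (k + 1) * f * (T k * T (k + 1) * T k) := by rw [hf.eq]; simp only [mul_assoc]
    _ = _ := by rw [hb]; simp only [mul_assoc]

/-- The relative trace takes values in the centraliser. -/
theorem HeckeRel.commute_relTrace (h : HeckeRel q n T) (hq : q ≠ 0) (k : ℕ) (hk : k ≤ n) (f : A)
    (hf : ∀ i, 1 ≤ i → i + 1 < k → Commute (T i) f) :
    ∀ i, 1 ≤ i → i < k → Commute (T i) (relTrace q T k f) := by
  induction k generalizing f with
  | zero => intro i _ h2; omega
  | succ k ih =>
    intro i h1 h2
    rw [relTrace_succ]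
    rcases Nat.lt_or_ge i k with hik | hik
    · refine (hf i h1 (by omega)).add_right (ih (by omega) _ (fun j hj1 hj2 => ?_) i h1 hik)
      have hc := h.commute hj1 (show j + 2 ≤ k by omega) (by omega)
      exact ((hc.mul_right (hf j hj1 (by omega))).mul_right hc).smul_right _
    · obtain rfl : i = k := by omega
      obtain ⟨k, rfl⟩ : ∃ k, i = k + 1 := ⟨i - 1, by omega⟩
      rw [relTrace_succ, ← add_assoc]
      refine (h.commute_conj hq h1 (by omega) f).add_right ?_
      rcases Nat.eq_zero_or_pos k with rfl | hk0
      · simp [relTrace_zero]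
      refine (relTrace_commute_of_commute k _ _ (fun j hj1 hj2 => ?_) ?_).symm
      · exact h.commute hj1 (by omega) (by omega)
      · rw [mul_smul_comm, smul_mul_assoc, smul_smul]
        exact ((h.commute_braid_conj hk0 (by omega) (hf k hk0 (by omega))).smul_right _).symm

/-- The Jucys–Murphy elements attached to `p`, indexed from `0`. -/
def jm (q : ℂ) (T : ℕ → A) (p : A) : ℕ → A
  | 0 => p
  | k + 1 => q⁻¹ • (T (k + 1) * jm q T p k * T (k + 1))

variable {p : A}

theorem jm_commute_of_lt (h : HeckeRel q n T) (hp : TypeBRel n T p) (k i : ℕ) (hk : k + 2 ≤ i)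
    (hi : i < n) : Commute (T i) (jm q T p k) := by
  induction k with
  | zero => exact hp.comm i hk hi
  | succ k ih =>
    have hc := (h.commute (show 1 ≤ k + 1 by omega) hk hi).symm
    exact ((hc.mul_right (ih (by omega))).mul_right hc).smul_right _

theorem jm_commute_of_gt (h : HeckeRel q n T) (hp : TypeBRel n T p) (k i : ℕ) (hi : 1 ≤ i)
    (hik : i < k) (hk : k < n) : Commute (T i) (jm q T p k) := by
  induction k with
  | zero => omega
  | succ k ih =>
    rcases Nat.lt_or_ge i k with hlt | hge
    · have hc := h.commute hi (show i + 2 ≤ k + 1 by omega) hk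
      exact ((hc.mul_right (ih hlt (by omega))).mul_right hc).smul_right _
    · obtain rfl : i = k := by omega
      obtain ⟨k, rfl⟩ : ∃ k, i = k + 1 := ⟨i - 1, by omega⟩
      have hc := jm_commute_of_lt h hp k (k + 2) le_rfl hk
      have hb := h.braid (k + 1) hi hk
      simp only [jm]
      rw [mul_smul_comm, smul_mul_assoc]
      refine Commute.smul_right (Commute.smul_right ?_ _) _
      rw [Commute, SemiconjBy]
      calc T (k + 1) * (T (k + 2) * (T (k + 1) * jm q T p k * T (k + 1)) * T (k + 2))
          = (T (k + 1) * T (k + 2) * T (k + 1)) * jm q T p k * T (k + 1) * T (k + 2) := by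
            simp only [mul_assoc]
        _ = T (k + 2) * T (k + 1) * (T (k + 2) * jm q T p k) * T (k + 1) * T (k + 2) := by
            rw [hb]; simp only [mul_assoc]
        _ = T (k + 2) * T (k + 1) * jm q T p k * (T (k + 2) * T (k + 1) * T (k + 2)) := by
            rw [hc.eq]; simp only [mul_assoc]
        _ = _ := by rw [← hb]; simp only [mul_assoc]

theorem jm_commute_base (hp : TypeBRel n T p) (k : ℕ) (hk : k < n) :
    Commute p (jm q T p k) := by
  induction k with
  | zero => exact Commute.refl _
  | succ k ih =>
    rcases Nat.eq_zero_or_pos k with rfl | hk0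
    · refine Commute.smul_right ?_ _
      have := hp.braid hk
      simp only [jm, Commute, SemiconjBy, zero_add, mul_assoc] at this ⊢
      exact this
    · have hc := (hp.comm (k + 1) (by omega) hk).symm
      exact ((hc.mul_right (ih (by omega))).mul_right hc).smul_right _

theorem jm_commute_jm_of_lt (h : HeckeRel q n T) (hp : TypeBRel n T p) (j k : ℕ) (hjk : j < k)
    (hk : k < n) : Commute (jm q T p j) (jm q T p k) := by
  induction j with
  | zero => exact jm_commute_base hp k hk
  | succ j ih =>
    have hc := jm_commute_of_gt h hp k (j + 1) (by omega) hjk hk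
    exact ((hc.mul_left (ih (by omega))).mul_left hc).smul_left _

theorem jm_commute_jm (h : HeckeRel q n T) (hp : TypeBRel n T p) (j k : ℕ) (hj : j < n)
    (hk : k < n) : Commute (jm q T p j) (jm q T p k) := by
  rcases lt_trichotomy j k with hjk | rfl | hjk
  · exact jm_commute_jm_of_lt h hp j k hjk hk
  · exact Commute.refl _
  · exact (jm_commute_jm_of_lt h hp k j hjk hj).symm

theorem jm_succ_eq (hq : q ≠ 0) (k : ℕ) :
    T (k + 1) * jm q T p k * T (k + 1) = q • jm q T p (k + 1) := by
  simp only [jm]; rw [smul_smul, mul_inv_cancel₀ hq, one_smul]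

theorem mul_jm (h : HeckeRel q n T) (hq : q ≠ 0) (k : ℕ) (hk : k + 1 < n) :
    T (k + 1) * jm q T p k = jm q T p (k + 1) * T (k + 1) - (q - 1) • jm q T p (k + 1) := by
  have e := congrArg (· * T (k + 1)) (jm_succ_eq (T := T) (p := p) hq k)
  simp only [mul_assoc, smul_mul_assoc] at e
  rw [h.quad _ (by omega) hk] at e
  simp only [mul_add, mul_smul_comm, mul_one] at e
  rw [← mul_assoc, jm_succ_eq hq] at e
  have e2 := congrArg (q⁻¹ • ·) e
  simp only [smul_add, smul_smul] at e2
  rw [mul_left_comm, inv_mul_cancel₀ hq, mul_one, one_smul, one_smul] at e2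
  rw [← e2]; abel

theorem jm_mul (h : HeckeRel q n T) (hq : q ≠ 0) (k : ℕ) (hk : k + 1 < n) :
    jm q T p k * T (k + 1) = T (k + 1) * jm q T p (k + 1) - (q - 1) • jm q T p (k + 1) := by
  have e := congrArg (T (k + 1) * ·) (jm_succ_eq (T := T) (p := p) hq k)
  simp only [mul_smul_comm] at e
  rw [← mul_assoc, ← mul_assoc, h.quad _ (by omega) hk] at e
  simp only [add_mul, smul_mul_assoc, one_mul] at e
  rw [jm_succ_eq hq] at e
  have e2 := congrArg (q⁻¹ • ·) e
  simp only [smul_add, smul_smul] at e2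
  rw [mul_left_comm, inv_mul_cancel₀ hq, mul_one, one_smul, one_smul] at e2
  rw [← e2]; abel

theorem commute_jm_mul_jm (h : HeckeRel q n T) (hp : TypeBRel n T p) (hq : q ≠ 0) (k : ℕ)
    (hk : k + 1 < n) : Commute (T (k + 1)) (jm q T p k * jm q T p (k + 1)) := by
  have hc := jm_commute_jm h hp k (k + 1) (by omega) hk
  rw [Commute, SemiconjBy, ← mul_assoc, mul_jm h hq k hk, hc.eq, mul_assoc (jm q T p (k + 1)),
    jm_mul h hq k hk]
  simp only [mul_sub, sub_mul, smul_mul_assoc, mul_smul_comm, mul_assoc]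

/-- Jucys–Murphy elements as sums of (deformed) transpositions. -/
theorem relTrace_self (h : HeckeRel q n T) (hq : q ≠ 0) (k : ℕ) (hk : k < n ∨ k = 0) :
    (q - 1) • relTrace q T k (T k) = q • (jm q T 1 k - 1) := by
  induction k with
  | zero => simp [relTrace_zero, jm]
  | succ k ih =>
    have hkn : k + 1 < n := by omega
    have key : relTrace q T k (q⁻¹ • (T k * T (k + 1) * T k)) =
        q⁻¹ • (T (k + 1) * relTrace q T k (T k) * T (k + 1)) := by
      rcases Nat.eq_zero_or_pos k with rfl | hk0
      · simp [relTrace_zero]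
      have hc : ∀ i, 1 ≤ i → i < k → Commute (T i) (T (k + 1)) := fun i h1 h2 =>
        h.commute h1 (by omega) hkn
      rw [h.braid k hk0 hkn, map_smul, relTrace_mul_right _ _ _ hc, relTrace_mul_left _ _ _ hc]
    rw [relTrace_succ, key, smul_add, smul_comm (q - 1) q⁻¹, ← smul_mul_assoc (q - 1),
      ← mul_smul_comm (q - 1), ih (by omega)]
    simp only [mul_smul_comm, smul_mul_assoc, mul_sub, sub_mul, mul_one, jm_succ_eq hq]
    rw [smul_smul q⁻¹ q, inv_mul_cancel₀ hq, one_smul, h.quad _ (by omega) hkn, smul_sub]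
    abel

end Hecke

section Hecke

variable {A : Type*} [Ring A] [Algebra ℂ A] {q : ℂ} {n : ℕ} {T : ℕ → A}

/-- `R` is a two-sided inverse of `z - x`. -/
structure IsResolvent (z : ℂ) (x R : A) : Prop where
  mul_left : R * (z • (1 : A) - x) = 1
  mul_right : (z • (1 : A) - x) * R = 1

theorem IsResolvent.mul_eq {z : ℂ} {x R : A} (h : IsResolvent z x R) : R * x = z • R - 1 := by
  have := h.mul_left
  rw [mul_sub, mul_smul_comm, mul_one] at this
  rw [← this]; abel

theorem IsResolvent.commute {z : ℂ} {x R y : A} (h : IsResolvent z x R) (hy : Commute y x) :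
    Commute y R := by
  have hc : Commute y (z • (1 : A) - x) :=
    ((Commute.one_right y).smul_right z).sub_right hy
  have e : R * (y * (z • (1 : A) - x)) * R = R * ((z • (1 : A) - x) * y) * R := by rw [hc.eq]
  rw [Commute, SemiconjBy]
  rw [← mul_assoc R (z • (1 : A) - x), h.mul_left, one_mul, ← mul_assoc, mul_assoc (R * y),
    h.mul_right, mul_one] at e
  exact e.symm

theorem relTrace_resolvent_succ (h : HeckeRel q n T) (hq : q ≠ 0) (z : ℂ) (k : ℕ)
    (hk : k + 1 < n) {Rx Ry : A} (hx : IsResolvent z (jm q T 1 k) Rx)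
    (hy : IsResolvent z (jm q T 1 (k + 1)) Ry) :
    relTrace q T (k + 2) Ry * (z • (1 : A) - jm q T 1 (k + 1)) ^ 2 =
      (z • (1 : A) - q • jm q T 1 (k + 1)) * (z • (1 : A) - q⁻¹ • jm q T 1 (k + 1)) *
        relTrace q T (k + 1) Rx + (z - 1) • jm q T 1 (k + 1) := by
  have hp : TypeBRel n T (1 : A) := TypeBRel.one
  have hTt : (q - 1) • relTrace q T (k + 1) (T (k + 1)) = q • (jm q T 1 (k + 1) - 1) :=
    relTrace_self h hq (k + 1) (Or.inl hk)
  have c1 := mul_jm (p := (1 : A)) h hq k hk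
  have hYT : ∀ i, 1 ≤ i → i < k + 1 → Commute (T i) (jm q T 1 (k + 1)) := fun i h1 h2 =>
    jm_commute_of_gt h hp (k + 1) i h1 h2 hk
  have hXY : Commute (jm q T 1 k) (jm q T (1 : A) (k + 1)) :=
    jm_commute_jm h hp k (k + 1) (by omega) hk
  have hquad := h.quad (k + 1) (by omega) hk
  rw [relTrace_succ (k + 1)]
  generalize jm q T (1 : A) k = X at *
  generalize jm q T (1 : A) (k + 1) = Y at *
  generalize T (k + 1) = t at *
  have hRyT : ∀ i, 1 ≤ i → i < k + 1 → Commute (T i) Ry := fun i h1 h2 =>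
    hy.commute (hYT i h1 h2)
  have hRxRy : Commute Rx Ry := hy.commute (hx.commute hXY.symm).symm
  have hRxY : Commute Y Rx := hx.commute hXY.symm
  have hYRy : Commute Y Ry := hy.commute (Commute.refl _)
  have hRyY := hy.mul_eq
  have e1 : Ry * t = t * Rx + (q - 1) • (Ry * Y * Rx) := by
    have e : Ry * ((z • (1 : A) - Y) * t) * Rx =
        Ry * (t * (z • (1 : A) - X) - (q - 1) • Y) * Rx := by
      congr 2
      rw [sub_mul, mul_sub, c1]
      simp only [smul_mul_assoc, mul_smul_comm, one_mul, mul_one]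
      abel
    rw [← mul_assoc Ry, hy.mul_left, one_mul, mul_sub, sub_mul, ← mul_assoc Ry t,
      mul_assoc (Ry * t), hx.mul_right, mul_one, mul_smul_comm, smul_mul_assoc] at e
    rw [e]; abel
  have e2 : t * Ry * t = q • Rx + ((q - 1) * z) • (t * Rx * Ry) := by
    rw [mul_assoc, e1, hRyY, mul_add, ← mul_assoc, hquad, mul_assoc t Rx, hRxRy.eq]
    simp only [add_mul, sub_mul, smul_mul_assoc, one_mul, mul_sub, mul_smul_comm, ← mul_assoc]
    module
  have e3 : t * Rx = Ry * t - (q - 1) • (Y * Ry * Rx) := by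
    rw [e1, hYRy.eq]; abel
  have e4 : q⁻¹ • (t * Ry * t) =
      Rx + (q⁻¹ * (q - 1) * z) • (Ry * t * Ry - (q - 1) • (Y * Ry * Rx * Ry)) := by
    rw [e2, e3, smul_add, smul_smul, inv_mul_cancel₀ hq, one_smul, smul_smul, sub_mul (Ry * t),
      smul_mul_assoc, mul_assoc q⁻¹]
  have hΦ1 : relTrace q T (k + 1) (Ry * t * Ry) = Ry * relTrace q T (k + 1) t * Ry := by
    rw [relTrace_mul_right _ _ _ hRyT, relTrace_mul_left _ _ _ hRyT]
  have hΦ2 : relTrace q T (k + 1) (Y * Ry * Rx * Ry) = Y * Ry * relTrace q T (k + 1) Rx * Ry := by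
    rw [relTrace_mul_right _ _ _ hRyT, relTrace_mul_left]
    exact fun i h1 h2 => (hYT i h1 h2).mul_right (hRyT i h1 h2)
  have hSY : Commute (relTrace q T (k + 1) Rx) Y :=
    relTrace_commute_of_commute _ _ _ hYT hRxY.symm
  have e5 : (q⁻¹ * (q - 1) * z) • (Ry * relTrace q T (k + 1) t * Ry) =
      z • (Ry * (Y - 1) * Ry) := by
    have : (q - 1) • (Ry * relTrace q T (k + 1) t * Ry) = q • (Ry * (Y - 1) * Ry) := by
      rw [← smul_mul_assoc, ← mul_smul_comm, hTt]
      simp only [mul_smul_comm, smul_mul_assoc]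
    rw [mul_right_comm, mul_smul, this, smul_smul]
    congr 1
    field_simp
  rw [e4, map_add, map_smul, map_sub, map_smul, hΦ1, hΦ2, smul_sub, e5]
  generalize relTrace q T (k + 1) Rx = S at *
  have hcW : Commute Ry (z • (1 : A) - Y) := by rw [Commute, SemiconjBy, hy.mul_left, hy.mul_right]
  have hcW' : Commute (Y - 1) (z • (1 : A) - Y) :=
    (((Commute.one_right _).smul_right z).sub_right
      ((Commute.refl Y).sub_left (Commute.one_left _)))
  have f1 : Ry * (z • (1 : A) - Y) ^ 2 = z • (1 : A) - Y := by
    rw [pow_two, ← mul_assoc, hy.mul_left, one_mul]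
  have f2 : Ry * (Y - 1) * Ry * (z • (1 : A) - Y) ^ 2 = Y - 1 := by
    rw [mul_assoc _ Ry, f1, mul_assoc, hcW'.eq, ← mul_assoc, hy.mul_left, one_mul]
  have f3 : Y * Ry * S * Ry * (z • (1 : A) - Y) ^ 2 = Y * S := by
    have hSW : Commute S (z • (1 : A) - Y) :=
      ((Commute.one_right _).smul_right z).sub_right hSY
    rw [mul_assoc _ Ry, f1, mul_assoc, hSW.eq, ← mul_assoc, mul_assoc Y, hy.mul_left, mul_one]
  simp only [add_mul, sub_mul, smul_mul_assoc, f1, f2, f3]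
  simp only [pow_two, sub_mul, mul_sub, smul_mul_assoc, mul_smul_comm, one_mul,
    mul_one, mul_assoc]
  rw [hSY.eq, hSY.left_comm, hSY.eq]
  match_scalars <;> field_simp <;> ring

end Hecke

section Hecke

variable {A : Type*} [Ring A] [Algebra ℂ A] {q : ℂ} {n : ℕ} {T : ℕ → A}

theorem relTrace_resolvent_mul_prod (h : HeckeRel q n T) (hq : q ≠ 0) {D : Type*} [CommRing D]
    [Algebra ℂ D] (f : D →ₐ[ℂ] A) (x R : ℕ → D) (z : ℂ)
    (hx : ∀ k < n, f (x k) = jm q T 1 k) (hx0 : x 0 = 1)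
    (hR : ∀ k < n, R k * (z • 1 - x k) = 1) (k : ℕ) (hk : k < n) :
    ((q - 1) ^ 2 * z) • (relTrace q T (k + 1) (f (R k)) *
        f (∏ i ∈ Finset.range (k + 1), (z • 1 - x i) ^ 2)) =
      (-q * (z - 1)) • f (∏ i ∈ Finset.range (k + 1), (z • 1 - q • x i) * (z • 1 - q⁻¹ • x i) -
        ∏ i ∈ Finset.range (k + 1), (z • 1 - x i) ^ 2) := by
  induction k with
  | zero =>
    rw [relTrace_succ, relTrace_zero, add_zero, ← map_mul, ← map_smul, ← map_smul]
    congr 1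
    have h0 := hR 0 hk
    rw [hx0] at h0
    have : R 0 * (z • (1 : D) - 1) ^ 2 = z • (1 : D) - 1 := by
      rw [pow_two, ← mul_assoc, h0, one_mul]
    simp only [zero_add, Finset.prod_range_one, hx0]
    rw [this]
    simp only [Algebra.smul_def, mul_one]
    have hq' : algebraMap ℂ D q * algebraMap ℂ D q⁻¹ = 1 := by
      rw [← map_mul, mul_inv_cancel₀ hq, map_one]
    simp only [map_mul, map_sub, map_neg, map_one, map_pow]
    linear_combination (algebraMap ℂ D z - 1) * (algebraMap ℂ D q - algebraMap ℂ D z) * hq'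
  | succ k ih =>
    have ih := ih (by omega)
    have hres : ∀ j < n, IsResolvent z (jm q T 1 j) (f (R j)) := fun j hj => by
      constructor
      · rw [← hx j hj, ← map_one f, ← map_smul, ← map_sub, ← map_mul, hR j hj]
      · rw [← hx j hj, ← map_one f, ← map_smul, ← map_sub, ← map_mul, mul_comm, hR j hj]
    have key := relTrace_resolvent_succ h hq z k hk (hres k (by omega)) (hres (k + 1) hk)
    rw [← hx (k + 1) hk] at key
    rw [Finset.prod_range_succ, Finset.prod_range_succ _ (k + 1)]
    generalize (∏ i ∈ Finset.range (k + 1), (z • 1 - x i) ^ 2) = P at *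
    generalize (∏ i ∈ Finset.range (k + 1), (z • 1 - q • x i) * (z • 1 - q⁻¹ • x i)) = Q at *
    generalize x (k + 1) = y at *
    generalize relTrace q T (k + 1) (f (R k)) = S at *
    generalize relTrace q T (k + 1 + 1) (f (R (k + 1))) = S' at *
    have e1 : S' * f (P * (z • 1 - y) ^ 2) =
        f ((z • 1 - q • y) * (z • 1 - q⁻¹ • y)) * (S * f P) + f ((z - 1) • y * P) := by
      have : f (P * (z • 1 - y) ^ 2) = (z • (1 : A) - f y) ^ 2 * f P := by
        rw [mul_comm]; simp
      rw [this, ← mul_assoc, key]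
      simp only [map_mul, map_sub, map_smul, map_one, add_mul, mul_assoc]
    rw [e1, smul_add, ← mul_smul_comm, ih, mul_smul_comm, ← map_mul, ← map_smul, ← map_smul,
      ← map_add, ← map_smul]
    congr 1
    simp only [Algebra.smul_def, mul_one]
    have hq' : algebraMap ℂ D q * algebraMap ℂ D q⁻¹ = 1 := by
      rw [← map_mul, mul_inv_cancel₀ hq, map_one]
    simp only [map_mul, map_sub, map_neg, map_one, map_pow]
    generalize algebraMap ℂ D q = a at *
    generalize algebraMap ℂ D z = b at *
    linear_combination P * (b - 1) * (a * y ^ 2 - b * y) * hq'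

/-- A finite family containing `1` whose multiset of values is harmonic along multiplication
by `q` contains all powers of `q`. -/
theorem pow_mem_of_prod_eq (hq : q ≠ 0) (a : ℕ → ℂ) (hn : 0 < n) (ha : a 0 = 1) (s : Set ℂ)
    (hs : s.Finite)
    (H : ∀ z ∉ s, ∏ i ∈ Finset.range n, (z - q * a i) * (z - q⁻¹ * a i) =
      ∏ i ∈ Finset.range n, (z - a i) ^ 2) (k : ℕ) : ∃ i < n, a i = q ^ k := by
  open Polynomial in
  have hpoly : ∏ i ∈ Finset.range n, (X - C (q * a i)) * (X - C (q⁻¹ * a i)) =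
      ∏ i ∈ Finset.range n, (X - C (a i)) ^ 2 := by
    refine Polynomial.eq_of_infinite_eval_eq _ _ (hs.infinite_compl.mono fun z hz => ?_)
    simpa [Polynomial.eval_prod] using H z hz
  set M : Multiset ℂ := (Multiset.range n).map a with hM
  have hroots : M.map (q * ·) + M.map (q⁻¹ * ·) = 2 • M := by
    have e := congrArg Polynomial.roots hpoly
    have h1 : ∀ g : ℕ → ℂ, (∏ i ∈ Finset.range n, (Polynomial.X - Polynomial.C (g i))).roots =
        (Multiset.range n).map g := fun g => by
      have := Polynomial.roots_multiset_prod_X_sub_C ((Multiset.range n).map g)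
      rwa [Multiset.map_map] at this
    have h0 : ∀ g : ℕ → ℂ, (∏ i ∈ Finset.range n, (Polynomial.X - Polynomial.C (g i))) ≠ 0 :=
      fun g => Finset.prod_ne_zero_iff.2 fun i _ => Polynomial.X_sub_C_ne_zero _
    rw [Finset.prod_mul_distrib, Finset.prod_pow, Polynomial.roots_mul (mul_ne_zero (h0 _) (h0 _)),
      Polynomial.roots_pow, h1, h1, h1] at e
    simpa [hM, Multiset.map_map] using e
  have hcount : ∀ y, M.count (q⁻¹ * y) + M.count (q * y) = 2 * M.count y := fun y => by
    have e := congrArg (Multiset.count y) hroots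
    have c1 : (M.map (q * ·)).count y = M.count (q⁻¹ * y) := by
      rw [← Multiset.count_map_eq_count' (q * ·) M (mul_right_injective₀ hq),
        mul_inv_cancel_left₀ hq]
    have c2 : (M.map (q⁻¹ * ·)).count y = M.count (q * y) := by
      rw [← Multiset.count_map_eq_count' (q⁻¹ * ·) M (mul_right_injective₀ (inv_ne_zero hq)),
        inv_mul_cancel_left₀ hq]
    rwa [Multiset.count_add, Multiset.count_nsmul, c1, c2] at e
  set u : ℕ → ℤ := fun k => (M.count (q ^ k) : ℤ) with hu
  have hrec : ∀ k, u k + u (k + 2) = 2 * u (k + 1) := fun k => by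
    have e := hcount (q ^ (k + 1))
    have e1 : q⁻¹ * q ^ (k + 1) = q ^ k := by rw [pow_succ']; field_simp
    have e2 : q * q ^ (k + 1) = q ^ (k + 2) := by ring
    rw [e1, e2] at e
    simp only [hu]; exact_mod_cast e
  have hd : ∀ k, u (k + 1) - u k = u 1 - u 0 := fun k => by
    induction k with
    | zero => rfl
    | succ k ih => have := hrec k; rw [← ih]; linarith
  have hlin : ∀ k : ℕ, u k = u 0 + k * (u 1 - u 0) := fun k => by
    induction k with
    | zero => simp
    | succ k ih => have := hd k; push_cast; linarith
  have hb0 : ∀ k, 0 ≤ u k := fun k => by positivity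
  have hbn : ∀ k, u k ≤ n := fun k => by
    have := Multiset.count_le_card (q ^ k) M
    simp only [hM, Multiset.card_map, Multiset.card_range] at this
    simp only [hu]; exact_mod_cast this
  have hd0 : u 1 - u 0 = 0 := by
    have h1 := hlin (n + 1)
    have h2 := hb0 (n + 1)
    have h3 := hbn (n + 1)
    have h4 := hb0 0
    have h5 := hbn 0
    push_cast at h1
    by_contra hne
    rcases lt_or_gt_of_ne hne with h6 | h6 <;> nlinarith
  have hmem : (1 : ℂ) ∈ M := Multiset.mem_map.2 ⟨0, by simpa using hn, ha⟩
  have hpos : 0 < u k := by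
    rw [hlin k, hd0]
    have := Multiset.count_pos.2 hmem
    simp only [hu, pow_zero, mul_zero, add_zero]; exact_mod_cast this
  have : q ^ k ∈ M := Multiset.count_pos.1 (by simp only [hu] at hpos; exact_mod_cast hpos)
  obtain ⟨i, hi, e⟩ := Multiset.mem_map.1 this
  exact ⟨i, by simpa using hi, e⟩

theorem pow_ne_one_of_geom_sum_ne_zero (hq1 : q ≠ 1)
    (hg : ∀ k, 1 ≤ k → k ≤ n → ∑ j ∈ Finset.range k, q ^ j ≠ 0) (k : ℕ) (h1 : 1 ≤ k) (h2 : k ≤ n) : q ^ k ≠ 1 := fun e => by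
  have := mul_geom_sum q k
  rw [e, sub_self] at this
  exact (mul_ne_zero (sub_ne_zero.2 hq1) (hg k h1 h2)) this

theorem not_forall_pow_mem (hq : q ≠ 0) (hq1 : q ≠ 1)
    (hg : ∀ k, 1 ≤ k → k ≤ n → ∑ j ∈ Finset.range k, q ^ j ≠ 0) (a : ℕ → ℂ) :
    ¬ ∀ k, ∃ i < n, a i = q ^ k := fun H => by
  have hinj : Set.InjOn (fun k => q ^ k) (Finset.range (n + 1) : Set ℕ) := by
    have aux : ∀ i j, i < j → j ≤ n → q ^ i ≠ q ^ j := fun i j hij hj e => by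
      refine pow_ne_one_of_geom_sum_ne_zero hq1 hg (j - i) (by omega) (by omega) ?_
      have : q ^ i * q ^ (j - i) = q ^ i * 1 := by rw [← pow_add, mul_one, e]; congr 1; omega
      exact mul_left_cancel₀ (pow_ne_zero _ hq) this
    intro i hi j hj e
    simp only [Finset.coe_range, Set.mem_Iio] at hi hj
    rcases lt_trichotomy i j with hij | hij | hij
    · exact absurd e (aux i j hij (by omega))
    · exact hij
    · exact absurd e.symm (aux j i hij (by omega))
  have hsub : (Finset.range (n + 1)).image (fun k => q ^ k) ⊆ (Finset.range n).image a := by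
    intro y hy
    obtain ⟨k, -, rfl⟩ := Finset.mem_image.1 hy
    obtain ⟨i, hi, e⟩ := H k
    exact Finset.mem_image.2 ⟨i, by simpa using hi, e⟩
  have := Finset.card_le_card hsub
  rw [Finset.card_image_of_injOn hinj] at this
  have h2 := Finset.card_image_le (s := Finset.range n) (f := a)
  simp only [Finset.card_range] at this h2
  omega

end Hecke

section Hecke

theorem finite_spectrum_of_finiteDimensional {D : Type*} [Ring D] [Algebra ℂ D] [Nontrivial D]
    [FiniteDimensional ℂ D] (d : D) : (spectrum ℂ d).Finite := by
  have hi : IsIntegral ℂ d := Algebra.IsIntegral.isIntegral d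
  refine (Multiset.finite_toSet (minpoly ℂ d).roots).subset fun μ hμ => ?_
  have := spectrum.subset_polynomial_aeval d (minpoly ℂ d) ⟨μ, hμ, rfl⟩
  rw [minpoly.aeval, spectrum.zero_eq] at this
  exact (Polynomial.mem_roots (minpoly.ne_zero hi)).2 this

theorem exists_algHom_of_ne_top {D : Type*} [CommRing D] [Algebra ℂ D]
    [FiniteDimensional ℂ D] (I : Ideal D) (hI : I ≠ ⊤) :
    ∃ χ : D →ₐ[ℂ] ℂ, ∀ d ∈ I, χ d = 0 := by
  obtain ⟨m, hm, hIm⟩ := Ideal.exists_le_maximal I hI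
  have hb : Function.Bijective (algebraMap ℂ (D ⧸ m)) :=
    IsAlgClosed.algebraMap_bijective_of_isIntegral
  let e := AlgEquiv.ofBijective (Algebra.ofId ℂ (D ⧸ m)) hb
  refine ⟨e.symm.toAlgHom.comp (Ideal.Quotient.mkₐ ℂ m), fun d hd => ?_⟩
  have : Ideal.Quotient.mk m d = 0 := Ideal.Quotient.eq_zero_iff_mem.2 (hIm hd)
  simp [this]

variable {A : Type*} [Ring A] [Algebra ℂ A] {q : ℂ} {n : ℕ} {T : ℕ → A}

theorem commute_of_adjoin_eq_top {s : Set A} (hs : Algebra.adjoin ℂ s = ⊤) {a : A}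
    (ha : ∀ x ∈ s, Commute x a) (b : A) : Commute b a := by
  have hb : b ∈ Algebra.adjoin ℂ s := hs ▸ Algebra.mem_top
  induction hb using Algebra.adjoin_induction with
  | mem x hx => exact ha x hx
  | algebraMap r => exact Algebra.commutes r a
  | add x y _ _ hx hy => exact hx.add_left hy
  | mul x y _ _ hx hy => exact hx.mul_left hy

theorem relTrace_one_of_q_eq_one (h : HeckeRel 1 n T) (k : ℕ) (hk : k ≤ n) :
    relTrace 1 T k (1 : A) = (k : ℂ) • (1 : A) := by
  induction k with
  | zero => simp [relTrace_zero]
  | succ k ih =>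
    rcases Nat.eq_zero_or_pos k with rfl | hk0
    · simp [relTrace_succ, relTrace_zero]
    · rw [relTrace_succ, mul_one, h.quad k hk0 hk]
      simp only [sub_self, zero_smul, zero_add, inv_one, one_smul]
      rw [ih (by omega)]
      push_cast
      rw [add_smul, one_smul, add_comm]

/-- The values of the relative trace on the centralizer of `T 1, …, T (n - 2)` form an ideal
of the centre. -/
def relTraceIdeal (q : ℂ) (n : ℕ) (T : ℕ → A) : Ideal (Subalgebra.center ℂ A) where
  carrier := {c | ∃ b : A, (∀ i, 1 ≤ i → i + 1 < n → Commute (T i) b) ∧ relTrace q T n b = c}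
  add_mem' := by
    rintro x y ⟨b, hb, hx⟩ ⟨c, hc, hy⟩
    exact ⟨b + c, fun i h1 h2 => (hb i h1 h2).add_right (hc i h1 h2), by rw [map_add, hx, hy]; rfl⟩
  zero_mem' := ⟨0, fun i _ _ => Commute.zero_right _, by simp⟩
  smul_mem' := by
    rintro c x ⟨b, hb, hx⟩
    have hc : ∀ a : A, Commute a c := fun a => (Subalgebra.mem_center_iff.1 c.2 a)
    refine ⟨c * b, fun i h1 h2 => (hc _).mul_right (hb i h1 h2), ?_⟩
    rw [relTrace_mul_left _ _ _ fun i _ _ => hc _, hx]; rfl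

theorem relTrace_mem_center (h : HeckeRel q n T) (hq : q ≠ 0)
    (hT : Algebra.adjoin ℂ (T '' Set.Ico 1 n) = ⊤) (b : A)
    (hb : ∀ i, 1 ≤ i → i + 1 < n → Commute (T i) b) :
    relTrace q T n b ∈ Subalgebra.center ℂ A := by
  rw [Subalgebra.mem_center_iff]
  refine commute_of_adjoin_eq_top hT ?_
  rintro _ ⟨i, hi, rfl⟩
  exact h.commute_relTrace hq n le_rfl b hb i hi.1 hi.2

theorem exists_relTrace_eq_one [FiniteDimensional ℂ A] (h : HeckeRel q n T) (hq : q ≠ 0)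
    (hT : Algebra.adjoin ℂ (T '' Set.Ico 1 n) = ⊤) (hn : 0 < n)
    (hg : ∀ k, 1 ≤ k → k ≤ n → ∑ j ∈ Finset.range k, q ^ j ≠ 0) :
    ∃ b : A, (∀ i, 1 ≤ i → i + 1 < n → Commute (T i) b) ∧ relTrace q T n b = 1 := by
  by_cases hq1 : q = 1
  · subst hq1
    refine ⟨(n : ℂ)⁻¹ • (1 : A), fun i _ _ => (Commute.one_right _).smul_right _, ?_⟩
    rw [map_smul, relTrace_one_of_q_eq_one h n le_rfl, smul_smul, inv_mul_cancel₀, one_smul]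
    exact_mod_cast hn.ne'
  set J := relTraceIdeal q n T with hJ
  set N : Submodule (Subalgebra.center ℂ A) A := J • ⊤ with hN
  have hNmul : ∀ a x : A, x ∈ N → a * x ∈ N := fun a x hx => by
    refine Submodule.smul_induction_on hx (fun r hr y _ => ?_) (fun x y hx hy => ?_)
    · have : a * r • y = r • (a * y) := by
        rw [Subalgebra.smul_def, Subalgebra.smul_def, smul_eq_mul, smul_eq_mul, ← mul_assoc,
          ← mul_assoc, Subalgebra.mem_center_iff.1 r.2 a]
      rw [this]
      exact Submodule.smul_mem_smul hr trivial
    · rw [mul_add]; exact N.add_mem hx hy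
  by_cases hN1 : (1 : A) ∈ N
  · have hNtop : (⊤ : Submodule (Subalgebra.center ℂ A) A) ≤ J • ⊤ := fun a _ => by
      have := hNmul a 1 hN1; rwa [mul_one] at this
    have : Module.Finite (Subalgebra.center ℂ A) A := Module.Finite.of_restrictScalars_finite ℂ _ _
    obtain ⟨r, hr, hr0⟩ := Submodule.exists_sub_one_mem_and_smul_eq_zero_of_fg_of_le_smul J ⊤
      Module.Finite.fg_top hNtop
    have h0 : r = 0 := by
      have := hr0 1 trivial
      apply Subtype.ext
      simpa [Subalgebra.smul_def] using this
    have h1 : (1 : Subalgebra.center ℂ A) ∈ J := by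
      have e := J.neg_mem hr
      rw [h0] at e
      convert e using 1
      apply Subtype.ext
      show (1 : A) = -(0 - 1)
      simp
    obtain ⟨b, hb, e⟩ := h1
    exact ⟨b, hb, e⟩
  exfalso
  have hp : TypeBRel n T (1 : A) := TypeBRel.one
  set s : Set A := (jm q T 1) '' Set.Iio n with hs
  have hcomm : ∀ a ∈ s, ∀ b ∈ s, a * b = b * a := by
    rintro _ ⟨i, hi, rfl⟩ _ ⟨j, hj, rfl⟩
    exact jm_commute_jm h hp i j hi hj
  have hmc := Algebra.isMulCommutative_adjoin ℂ hcomm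
  let _ : CommRing (Algebra.adjoin ℂ s) :=
    { (inferInstance : Ring (Algebra.adjoin ℂ s)) with mul_comm := hmc.is_comm.comm }
  let f : Algebra.adjoin ℂ s →ₐ[ℂ] A := (Algebra.adjoin ℂ s).val
  let I : Ideal (Algebra.adjoin ℂ s) :=
    { carrier := {d | (d : A) ∈ N}
      add_mem' := fun hx hy => N.add_mem hx hy
      zero_mem' := N.zero_mem
      smul_mem' := fun a x hx => hNmul a x hx }
  have hI : I ≠ ⊤ := fun e => hN1 (by
    have : (1 : Algebra.adjoin ℂ s) ∈ I := e ▸ trivial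
    exact this)
  obtain ⟨χ, hχ⟩ := exists_algHom_of_ne_top I hI
  have : Nontrivial (Algebra.adjoin ℂ s) := χ.toRingHom.domain_nontrivial
  let x : ℕ → Algebra.adjoin ℂ s := fun k =>
    if hk : k < n then ⟨jm q T 1 k, Algebra.subset_adjoin ⟨k, hk, rfl⟩⟩ else 0
  have hx : ∀ k < n, f (x k) = jm q T 1 k := fun k hk => by simp [f, x, hk]
  have hx0 : x 0 = 1 := by
    apply Subtype.ext
    have := hx 0 hn
    exact this
  refine not_forall_pow_mem hq hq1 hg (fun i => χ (x i)) (pow_mem_of_prod_eq hq _ hn (by simp [hx0])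
    ((⋃ i ∈ Set.Iio n, spectrum ℂ (x i)) ∪ {0, 1}) ?_ ?_)
  · exact ((Set.finite_Iio n).biUnion fun i _ =>
      finite_spectrum_of_finiteDimensional (x i)).union (by simp)
  intro z hz
  simp only [Set.mem_union, Set.mem_iUnion, Set.mem_Iio, not_or, not_exists, Set.mem_insert_iff,
    Set.mem_singleton_iff] at hz
  obtain ⟨hz1, hz0, hz2⟩ := hz
  have hR : ∀ k, ∃ R, k < n → R * (z • 1 - x k) = 1 := fun k => by
    by_cases hk : k < n
    · have := hz1 k hk
      rw [spectrum.mem_iff, not_not, Algebra.algebraMap_eq_smul_one] at this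
      obtain ⟨R, hR⟩ := this.exists_left_inv
      exact ⟨R, fun _ => hR⟩
    · exact ⟨0, fun h => absurd h hk⟩
  choose R hR using hR
  obtain ⟨m, rfl⟩ : ∃ m, n = m + 1 := ⟨n - 1, by omega⟩
  have key := relTrace_resolvent_mul_prod h hq f x R z hx hx0 hR m (by omega)
  have hres : IsResolvent z (jm q T 1 m) (f (R m)) := by
    constructor
    · rw [← hx m (by omega), ← map_one f, ← map_smul, ← map_sub, ← map_mul, hR m (by omega)]
    · rw [← hx m (by omega), ← map_one f, ← map_smul, ← map_sub, ← map_mul, mul_comm,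
        hR m (by omega)]
  have hbc : ∀ i, 1 ≤ i → i + 1 < m + 1 → Commute (T i) (f (R m)) := fun i h1 h2 =>
    hres.commute (jm_commute_of_gt h hp m i h1 (by omega) (by omega))
  have hmemN : relTrace q T (m + 1) (f (R m)) ∈ N := by
    have hc := relTrace_mem_center h hq hT _ hbc
    have hj : (⟨_, hc⟩ : Subalgebra.center ℂ A) ∈ J := ⟨_, hbc, rfl⟩
    have := Submodule.smul_mem_smul hj (Submodule.mem_top (x := (1 : A)))
    rw [Subalgebra.smul_def, smul_eq_mul, mul_one] at this
    exact this
  have hNsmul : ∀ (c : ℂ) (y : A), y ∈ N → c • y ∈ N := fun c y hy => by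
    have := hNmul (algebraMap ℂ A c) y hy
    rwa [← Algebra.smul_def] at this
  set P := ∏ i ∈ Finset.range (m + 1), (z • 1 - x i) ^ 2 with hP
  set Q := ∏ i ∈ Finset.range (m + 1), (z • 1 - q • x i) * (z • 1 - q⁻¹ • x i) with hQ
  have hmemI : Q - P ∈ I := by
    have h1 : (-q * (z - 1)) • f (Q - P) ∈ N := by
      rw [← key]
      refine hNsmul _ _ ?_
      have hc := relTrace_mem_center h hq hT _ hbc
      rw [← Subalgebra.mem_center_iff.1 hc]
      exact hNmul _ _ hmemN
    have h2 := hNsmul (-q * (z - 1))⁻¹ _ h1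
    rw [smul_smul, inv_mul_cancel₀ (mul_ne_zero (neg_ne_zero.2 hq) (sub_ne_zero.2 hz2)),
      one_smul] at h2
    exact h2
  have := hχ _ hmemI
  rw [map_sub, sub_eq_zero] at this
  simpa [hP, hQ, map_prod] using this

end Hecke

section Hecke

variable {A : Type*} [Ring A] [Algebra ℂ A] {q : ℂ} {n : ℕ} {T : ℕ → A}

theorem commute_of_mem_adjoin {s : Set A} {a b : A} (ha : ∀ x ∈ s, Commute x a)
    (hb : b ∈ Algebra.adjoin ℂ s) : Commute b a := by
  induction hb using Algebra.adjoin_induction with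
  | mem x hx => exact ha x hx
  | algebraMap r => exact Algebra.commutes r a
  | add x y _ _ hx hy => exact hx.add_left hy
  | mul x y _ _ hx hy => exact hx.mul_left hy

theorem image_succ_Ico {B : Type*} (T : ℕ → B) (a b : ℕ) :
    (fun i => T (i + 1)) '' Set.Ico a b = T '' Set.Ico (a + 1) (b + 1) := by
  ext x; constructor
  · rintro ⟨i, ⟨h1, h2⟩, rfl⟩; exact ⟨i + 1, ⟨by omega, by omega⟩, rfl⟩
  · rintro ⟨i, ⟨h1, h2⟩, rfl⟩
    exact ⟨i - 1, ⟨by omega, by omega⟩, by simp only; congr 1; omega⟩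

open Subalgebra in
/-- The double coset decomposition of a Hecke algebra with respect to the subalgebra generated by
`T 2, …, T (n - 1)`. -/
theorem HeckeRel.adjoin_le (h : HeckeRel q n T) :
    toSubmodule (Algebra.adjoin ℂ (T '' Set.Ico 1 n)) ≤
      toSubmodule (Algebra.adjoin ℂ (T '' Set.Ico 2 n)) * Submodule.span ℂ {1, T 1} *
        toSubmodule (Algebra.adjoin ℂ (T '' Set.Ico 2 n)) := by
  have base : ∀ (T : ℕ → A), ∀ m ≤ 1, toSubmodule (Algebra.adjoin ℂ (T '' Set.Ico 1 m)) ≤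
      toSubmodule (Algebra.adjoin ℂ (T '' Set.Ico 2 m)) * Submodule.span ℂ {1, T 1} *
        toSubmodule (Algebra.adjoin ℂ (T '' Set.Ico 2 m)) := fun T m hm => by
    rw [Set.Ico_eq_empty_of_le (by omega : m ≤ 1), Set.Ico_eq_empty_of_le (by omega : m ≤ 2),
      Set.image_empty, Algebra.adjoin_empty]
    simp only [Algebra.toSubmodule_bot, Submodule.one_mul, Submodule.mul_one]
    rw [Submodule.one_eq_span]
    exact Submodule.span_mono (by simp)
  induction n generalizing T with
  | zero => exact base T 0 (by omega)
  | succ n ih =>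
    rcases Nat.eq_zero_or_pos n with rfl | hn0
    · exact base T 1 le_rfl
    set H' := Algebra.adjoin ℂ (T '' Set.Ico 2 (n + 1)) with hH'
    set E := Submodule.span ℂ {1, T 1} with hE
    have h1E : (1 : Submodule ℂ A) ≤ E := by
      rw [Submodule.one_eq_span]; exact Submodule.span_mono (by simp)
    have h1H : (1 : Submodule ℂ A) ≤ toSubmodule H' := by
      rw [Submodule.one_le]; exact H'.one_mem
    have hHH : toSubmodule H' * toSubmodule H' = toSubmodule H' := Subalgebra.isIdempotentElem_toSubmodule H'
    have hHM : toSubmodule H' ≤ toSubmodule H' * E * toSubmodule H' := by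
      calc toSubmodule H' = toSubmodule H' * 1 * 1 := by simp
        _ ≤ _ := mul_le_mul' (mul_le_mul' le_rfl h1E) h1H
    have hEM : E ≤ toSubmodule H' * E * toSubmodule H' := by
      calc E = 1 * E * 1 := by simp
        _ ≤ _ := mul_le_mul' (mul_le_mul' h1H le_rfl) h1H
    have key : E * toSubmodule H' * E ≤ toSubmodule H' * E * toSubmodule H' := by
      rcases Nat.lt_or_ge n 2 with hn | hn
      · have hb : H' = ⊥ := by
          rw [hH', Set.Ico_eq_empty_of_le (by omega : n + 1 ≤ 2), Set.image_empty,
            Algebra.adjoin_empty]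
        rw [hb]
        simp only [Algebra.toSubmodule_bot, Submodule.one_mul, Submodule.mul_one]
        rw [hE, Submodule.span_mul_span, Submodule.span_le]
        rintro _ ⟨x, hx, y, hy, rfl⟩
        simp only [Set.mem_insert_iff, Set.mem_singleton_iff] at hx hy
        have m1 : (1 : A) ∈ Submodule.span ℂ {1, T 1} := Submodule.subset_span (by simp)
        have m2 : T 1 ∈ Submodule.span ℂ {1, T 1} := Submodule.subset_span (by simp)
        rcases hx with rfl | rfl <;> rcases hy with rfl | rfl <;>
          simp only [mul_one, one_mul, SetLike.mem_coe]
        · exact m1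
        · exact m2
        · exact m2
        · rw [h.quad 1 le_rfl (by omega)]
          exact add_mem (Submodule.smul_mem _ _ m2) (Submodule.smul_mem _ _ m1)
      · have hs := ih (T := fun i => T (i + 1)) h.shift
        rw [image_succ_Ico, image_succ_Ico, ← hH'] at hs
        set H'' := Algebra.adjoin ℂ (T '' Set.Ico 3 (n + 1)) with hH''
        set F := Submodule.span ℂ {1, T (1 + 1)} with hF
        have hle : toSubmodule H'' ≤ toSubmodule H' :=
          Algebra.adjoin_mono (Set.image_mono (Set.Ico_subset_Ico_left (by omega)))
        have hc : E * toSubmodule H'' = toSubmodule H'' * E := by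
          refine Submodule.mul_comm_of_commute fun x hx y hy => ?_
          refine (commute_of_mem_adjoin (a := x) ?_ hy).symm
          rintro _ ⟨i, ⟨h1, h2⟩, rfl⟩
          induction hx using Submodule.span_induction with
          | mem x hx =>
            rcases hx with rfl | hx
            · exact Commute.one_right _
            · rw [Set.mem_singleton_iff.1 hx]; exact (h.comm 1 i le_rfl h1 h2).symm
          | zero => exact Commute.zero_right _
          | add x y _ _ hx hy => exact hx.add_right hy
          | smul c x _ hx => exact hx.smul_right c
        have hEFE : E * F * E ≤ toSubmodule H' * E * toSubmodule H' := by
          have mE : ∀ x ∈ E, x ∈ toSubmodule H' * E * toSubmodule H' := fun x hx => hEM hx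
          have m1 : (1 : A) ∈ E := Submodule.subset_span (by simp)
          have m2 : T 1 ∈ E := Submodule.subset_span (by simp)
          have t2 : T (1 + 1) ∈ toSubmodule H' :=
            Algebra.subset_adjoin ⟨2, ⟨le_rfl, by omega⟩, rfl⟩
          have o2 : (1 : A) ∈ toSubmodule H' := H'.one_mem
          have e1 : T 1 * T (1 + 1) ∈ toSubmodule H' * E * toSubmodule H' := by
            have := Submodule.mul_mem_mul (Submodule.mul_mem_mul o2 m2) t2
            rwa [one_mul] at this
          have e2 : T (1 + 1) * T 1 ∈ toSubmodule H' * E * toSubmodule H' := by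
            have := Submodule.mul_mem_mul (Submodule.mul_mem_mul t2 m2) o2
            rwa [mul_one] at this
          have e3 : T 1 * T (1 + 1) * T 1 ∈ toSubmodule H' * E * toSubmodule H' := by
            rw [h.braid 1 le_rfl (by omega)]
            exact Submodule.mul_mem_mul (Submodule.mul_mem_mul t2 m2) t2
          have e4 : T 1 * T 1 ∈ toSubmodule H' * E * toSubmodule H' := by
            rw [h.quad 1 le_rfl (by omega)]
            exact mE _ (add_mem (Submodule.smul_mem _ _ m2) (Submodule.smul_mem _ _ m1))
          rw [hE, hF, Submodule.span_mul_span, Submodule.span_mul_span, Submodule.span_le]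
          rintro _ ⟨_, ⟨x, hx, y, hy, rfl⟩, w, hw, rfl⟩
          simp only [Set.mem_insert_iff, Set.mem_singleton_iff] at hx hy hw
          rcases hx with rfl | rfl <;> rcases hy with rfl | rfl <;> rcases hw with rfl | rfl <;>
            simp only [mul_one, one_mul, SetLike.mem_coe]
          · exact mE _ m1
          · exact mE _ m2
          · exact hHM t2
          · exact e2
          · exact mE _ m2
          · exact e4
          · exact e1
          · exact e3
        calc E * toSubmodule H' * E
            ≤ E * (toSubmodule H'' * F * toSubmodule H'') * E :=
              mul_le_mul' (mul_le_mul' le_rfl hs) le_rfl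
          _ = toSubmodule H'' * (E * F * E) * toSubmodule H'' := by
              simp only [← mul_assoc, hc]
              rw [mul_assoc _ _ E, ← hc, ← mul_assoc]
          _ ≤ toSubmodule H' * (toSubmodule H' * E * toSubmodule H') * toSubmodule H' :=
              mul_le_mul' (mul_le_mul' hle hEFE) hle
          _ = toSubmodule H' * E * toSubmodule H' := by
              rw [mul_assoc, mul_assoc, hHH, ← mul_assoc, ← mul_assoc, hHH]
    have hMM : (toSubmodule H' * E * toSubmodule H') * (toSubmodule H' * E * toSubmodule H') ≤
        toSubmodule H' * E * toSubmodule H' := by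
      calc _ = toSubmodule H' * (E * (toSubmodule H' * toSubmodule H') * E) * toSubmodule H' := by
              simp only [mul_assoc]
        _ ≤ toSubmodule H' * (toSubmodule H' * E * toSubmodule H') * toSubmodule H' := by
              rw [hHH]; exact mul_le_mul' (mul_le_mul' le_rfl key) le_rfl
        _ = _ := by
              rw [mul_assoc, mul_assoc, hHH, ← mul_assoc, ← mul_assoc, hHH]
    intro x hx
    rw [mem_toSubmodule] at hx
    induction hx using Algebra.adjoin_induction with
    | mem x hx =>
      obtain ⟨i, ⟨h1, h2⟩, rfl⟩ := hx
      rcases Nat.eq_or_lt_of_le h1 with rfl | h1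
      · exact hEM (Submodule.subset_span (by simp))
      · exact hHM (Algebra.subset_adjoin ⟨i, ⟨h1, h2⟩, rfl⟩)
    | algebraMap r => exact hHM (H'.algebraMap_mem r)
    | add x y _ _ hx hy => exact add_mem hx hy
    | mul x y _ _ hx hy => exact hMM (Submodule.mul_mem_mul hx hy)

theorem HeckeRel.fg_adjoin (h : HeckeRel q n T) :
    (Subalgebra.toSubmodule (Algebra.adjoin ℂ (T '' Set.Ico 1 n))).FG := by
  induction n generalizing T with
  | zero =>
    rw [Set.Ico_eq_empty_of_le (by omega : 0 ≤ 1), Set.image_empty, Algebra.adjoin_empty,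
      Algebra.toSubmodule_bot, Submodule.one_eq_span]
    exact Submodule.fg_span_singleton _
  | succ n ih =>
    have hs := ih (T := fun i => T (i + 1)) h.shift
    rw [image_succ_Ico] at hs
    exact ((hs.mul (Submodule.fg_span (by simp))).mul hs).of_le h.adjoin_le

end Hecke

section Hecke

universe u

/-- The family `T` on `I`, viewed in the subalgebra it generates (and `0` off `I`). -/
def restrictGen {A : Type*} [Ring A] [Algebra ℂ A] (T : ℕ → A) (I : Set ℕ) :
    ℕ → Algebra.adjoin ℂ (T '' I) :=
  open Classical in fun i =>
    if h : i ∈ I then ⟨T i, Algebra.subset_adjoin (Set.mem_image_of_mem T h)⟩ else 0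

section
variable {A : Type u} [Ring A] [Algebra ℂ A] {q : ℂ} {n : ℕ} {T : ℕ → A}

theorem coe_restrictGen {I : Set ℕ} {i : ℕ} (h : i ∈ I) : (restrictGen T I i : A) = T i := by
  simp [restrictGen, h]

theorem adjoin_restrictGen (T : ℕ → A) (I : Set ℕ) :
    Algebra.adjoin ℂ (restrictGen T I '' I) = ⊤ := by
  rw [← Algebra.adjoin_adjoin_coe_preimage]
  congr 1
  ext x
  constructor
  · rintro ⟨i, hi, rfl⟩
    exact ⟨i, hi, (coe_restrictGen hi).symm⟩
  · rintro ⟨i, hi, e⟩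
    exact ⟨i, hi, Subtype.ext ((coe_restrictGen hi).trans e)⟩

theorem HeckeRel.restrictGen (h : HeckeRel q n T) {I : Set ℕ} (hI : Set.Ico 1 n ⊆ I) :
    HeckeRel q n (restrictGen T I) := by
  have hc : ∀ i, 1 ≤ i → i < n → (_root_.restrictGen T I i : A) = T i :=
    fun i h1 h2 => coe_restrictGen (hI ⟨h1, h2⟩)
  refine ⟨fun i h1 h2 => Subtype.ext ?_, fun i h1 h2 => Subtype.ext ?_,
    fun i j h1 h2 h3 => Subtype.ext ?_⟩
  · simpa [hc i h1 h2] using h.quad i h1 h2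
  · simpa [hc i h1 (by omega), hc (i + 1) (by omega) h2] using h.braid i h1 h2
  · simpa [hc i h1 (by omega), hc j (by omega) h3] using h.comm i j h1 h2 h3

theorem isSemisimpleRing_of_adjoin_empty (h : Algebra.adjoin ℂ (∅ : Set A) = ⊤) :
    IsSemisimpleRing A := by
  rw [Algebra.adjoin_empty] at h
  exact RingHom.isSemisimpleRing_of_surjective (algebraMap ℂ A) fun a => by
    have : a ∈ (⊥ : Subalgebra ℂ A) := h ▸ Algebra.mem_top
    exact Algebra.mem_bot.1 this

theorem relTrace_eqOn {V : Type*} [AddCommGroup V] [Module ℂ V] {S : ℕ → Module.End ℂ V}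
    (N : Submodule ℂ V) (k : ℕ) (hN : ∀ i, 1 ≤ i → i < k → ∀ x ∈ N, S i x ∈ N)
    (f g : Module.End ℂ V) (hfg : ∀ x ∈ N, f x = g x) :
    ∀ x ∈ N, relTrace q S k f x = relTrace q S k g x := by
  induction k generalizing f g with
  | zero => simp [relTrace_zero]
  | succ k ih =>
    intro x hx
    rw [relTrace_succ, relTrace_succ, LinearMap.add_apply, LinearMap.add_apply, hfg x hx]
    rcases Nat.eq_zero_or_pos k with rfl | hk
    · rfl
    · rw [ih (fun i h1 h2 => hN i h1 (by omega)) _ _ (fun y hy => ?_) x hx]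
      simp [Module.End.mul_apply, hfg _ (hN k hk (by omega) y hy)]

theorem relTrace_mapsTo {V : Type*} [AddCommGroup V] [Module ℂ V] {S : ℕ → Module.End ℂ V}
    (N : Submodule ℂ V) (k : ℕ) (hN : ∀ i, 1 ≤ i → i < k → ∀ x ∈ N, S i x ∈ N)
    (f : Module.End ℂ V) (hf : ∀ x, f x ∈ N) (x : V) : relTrace q S k f x ∈ N := by
  induction k generalizing f with
  | zero => simp [relTrace_zero]
  | succ k ih =>
    rw [relTrace_succ, LinearMap.add_apply]
    refine add_mem (hf x) ?_
    rcases Nat.eq_zero_or_pos k with rfl | hk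
    · simp [relTrace_zero]
    · refine ih (fun i h1 h2 => hN i h1 (by omega)) _ fun y => ?_
      exact N.smul_mem _ (hN k hk (by omega) _ (hf _))

theorem map_relTrace {B : Type*} [Ring B] [Algebra ℂ B] (φ : A →ₐ[ℂ] B) (k : ℕ) (f : A) :
    φ (relTrace q T k f) = relTrace q (fun i => φ (T i)) k (φ f) := by
  induction k generalizing f with
  | zero => simp [relTrace_zero]
  | succ k ih => rw [relTrace_succ, relTrace_succ, map_add, ih]; simp

/-- Relative Maschke theorem: if some element commuting with `T 1, …, T (n - 1)` has relative
trace `1`, semisimplicity is inherited from the subalgebra generated by these elements. -/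
theorem HeckeRel.isSemisimpleRing_of_relTrace_eq_one (h : HeckeRel q (n + 1) T) (hq : q ≠ 0)
    (hT : Algebra.adjoin ℂ (T '' Set.Ico 1 (n + 1)) = ⊤)
    [IsSemisimpleRing (Algebra.adjoin ℂ (T '' Set.Ico 1 n))] (b : A)
    (hb : ∀ i, 1 ≤ i → i < n → Commute (T i) b) (hb1 : relTrace q T (n + 1) b = 1) :
    IsSemisimpleRing A := by
  refine (isSemisimpleModule_iff A A).2 ⟨fun N => ?_⟩
  let B := Algebra.adjoin ℂ (T '' Set.Ico 1 n)
  let NB : Submodule B A :=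
    { carrier := N, add_mem' := N.add_mem, zero_mem' := N.zero_mem
      smul_mem' := fun c x hx => N.smul_mem (c : A) hx }
  obtain ⟨C, hC⟩ := exists_isCompl NB
  let N' : Submodule ℂ A := N.restrictScalars ℂ
  let π : A →ₗ[B] A := NB.subtype ∘ₗ NB.projectionOnto C hC
  let π' : Module.End ℂ A := π.restrictScalars ℂ
  have hπ1 : ∀ x, π' x ∈ N := fun x => (NB.projectionOnto C hC x).2
  have hπ2 : ∀ x ∈ N, π' x = x := fun x hx =>
    congrArg Subtype.val (Submodule.projectionOnto_apply_left hC ⟨x, hx⟩)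
  have hπ3 : ∀ i, 1 ≤ i → i < n → ∀ x, π' (T i * x) = T i * π' x := fun i h1 h2 x =>
    π.map_smul (⟨T i, Algebra.subset_adjoin ⟨i, ⟨h1, h2⟩, rfl⟩⟩ : B) x
  let S : ℕ → Module.End ℂ A := fun i => Algebra.lmul ℂ A (T i)
  have hS : HeckeRel q (n + 1) S := h.map (Algebra.lmul ℂ A)
  let f : Module.End ℂ A := π' * Algebra.lmul ℂ A b
  have hf : ∀ i, 1 ≤ i → i + 1 < n + 1 → Commute (S i) f := fun i h1 h2 => by
    refine LinearMap.ext fun x => ?_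
    have e : b * (T i * x) = T i * (b * x) := by
      rw [← mul_assoc, ← (hb i h1 (by omega)).eq, mul_assoc]
    show T i * π' (b * x) = π' (b * (T i * x))
    rw [e, hπ3 i h1 (by omega)]
  have hFc := hS.commute_relTrace hq (n + 1) le_rfl f hf
  set F := relTrace q S (n + 1) f with hF
  have hFlin : ∀ a x : A, F (a * x) = a * F x := fun a => by
    have ha : a ∈ Algebra.adjoin ℂ (T '' Set.Ico 1 (n + 1)) := hT ▸ Algebra.mem_top
    induction ha using Algebra.adjoin_induction with
    | mem y hy =>
      obtain ⟨i, ⟨h1, h2⟩, rfl⟩ := hy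
      exact fun x => (LinearMap.congr_fun (hFc i h1 h2).eq x).symm
    | algebraMap r => intro x; rw [← Algebra.smul_def, ← Algebra.smul_def, map_smul]
    | add y z _ _ hy hz => intro x; rw [add_mul, map_add, hy, hz, add_mul]
    | mul y z _ _ hy hz => intro x; rw [mul_assoc, hy, hz, mul_assoc]
  have hstab : ∀ i, 1 ≤ i → i < n + 1 → ∀ x ∈ N', S i x ∈ N' := fun i _ _ x hx =>
    N.smul_mem (T i) hx
  have hFN : ∀ x, F x ∈ N := relTrace_mapsTo N' (n + 1) hstab f fun x => hπ1 _
  have hFid : ∀ x ∈ N, F x = x := fun x hx => by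
    rw [hF, relTrace_eqOn N' (n + 1) hstab f (Algebra.lmul ℂ A b)
      (fun y hy => hπ2 _ (N.smul_mem b hy)) x hx]
    have e : relTrace q S (n + 1) (Algebra.lmul ℂ A b) = Algebra.lmul ℂ A 1 := by
      rw [← hb1]; exact (map_relTrace (Algebra.lmul ℂ A) (n + 1) b).symm
    rw [e]; simp
  let P : A →ₗ[A] N :=
    { toFun := fun x => ⟨F x, hFN x⟩
      map_add' := fun x y => Subtype.ext (map_add F x y)
      map_smul' := fun a x => Subtype.ext (hFlin a x) }
  exact ⟨LinearMap.ker P, LinearMap.isCompl_of_proj fun x => Subtype.ext (hFid x x.2)⟩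

end

theorem HeckeRel.isSemisimpleRing {q : ℂ} (hq : q ≠ 0) (n : ℕ)
    (hg : ∀ k, 1 ≤ k → k ≤ n → ∑ j ∈ Finset.range k, q ^ j ≠ 0)
    {A : Type u} [Ring A] [Algebra ℂ A] {T : ℕ → A} (h : HeckeRel q n T)
    (hT : Algebra.adjoin ℂ (T '' Set.Ico 1 n) = ⊤) : IsSemisimpleRing A := by
  induction n generalizing A with
  | zero =>
    rw [Set.Ico_eq_empty_of_le (by omega : 0 ≤ 1), Set.image_empty] at hT
    exact isSemisimpleRing_of_adjoin_empty hT
  | succ n ih =>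
    have := ih (fun k h1 h2 => hg k h1 (by omega)) ((h.mono n.le_succ).restrictGen subset_rfl)
      (adjoin_restrictGen T (Set.Ico 1 n))
    have : FiniteDimensional ℂ A := by
      have hfg := h.fg_adjoin
      rw [hT, Algebra.top_toSubmodule] at hfg
      exact ⟨hfg⟩
    obtain ⟨b, hb, hb1⟩ := exists_relTrace_eq_one h hq hT n.succ_pos hg
    exact h.isSemisimpleRing_of_relTrace_eq_one hq hT b (fun i h1 h2 => hb i h1 (by omega)) hb1

end Hecke

section Mirabolic

universe u

/-- The relations of the mirabolic Hecke algebra, in terms of the idempotent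
`G 0 = q⁻¹ (q - 1 - T_0)` and the Hecke generators `G i = T_i`. -/
structure MirabolicRel {A : Type*} [Ring A] [Algebra ℂ A] (q : ℂ) (n : ℕ) (G : ℕ → A) : Prop where
  hecke : HeckeRel q n G
  idem : 0 < n → G 0 * G 0 = G 0
  comm : ∀ i, 2 ≤ i → i < n → Commute (G i) (G 0)
  left : 1 < n → (G 0 * G 1 * G 0 - (q - 1) • G 0) * (G 1 + 1) = 0
  right : 1 < n → (G 1 + 1) * (G 0 * G 1 * G 0 - (q - 1) • G 0) = 0

/-- The idempotent of the smaller mirabolic Hecke algebra. -/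
def subIdem {A : Type*} [Ring A] [Algebra ℂ A] (q : ℂ) (G : ℕ → A) : A :=
  q⁻¹ • ((q - 1) • G 0 - G 0 * G 1 * G 0)

/-- The generators of the smaller mirabolic Hecke algebra. -/
def subGen {A : Type*} [Ring A] [Algebra ℂ A] (q : ℂ) (G : ℕ → A) : ℕ → A
  | 0 => subIdem q G
  | i + 1 => G (i + 2)

variable {A : Type u} [Ring A] [Algebra ℂ A] {q : ℂ} {n : ℕ} {G : ℕ → A}

namespace MirabolicRel

theorem restrictGen (h : MirabolicRel q n G) :
    MirabolicRel q n (restrictGen G (Set.Iio n)) := by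
  have hc : ∀ i, i < n → (_root_.restrictGen G (Set.Iio n) i : A) = G i :=
    fun i h1 => coe_restrictGen h1
  refine ⟨h.hecke.restrictGen fun i hi => hi.2, fun h0 => Subtype.ext ?_,
    fun i h1 h2 => Subtype.ext ?_, fun h1 => Subtype.ext ?_, fun h1 => Subtype.ext ?_⟩
  · simpa [hc 0 h0] using h.idem h0
  · simpa [hc 0 (by omega), hc i h2] using (h.comm i h1 h2).eq
  · simpa [hc 0 (by omega), hc 1 h1] using h.left h1
  · simpa [hc 0 (by omega), hc 1 h1] using h.right h1

theorem typeBRel (h : MirabolicRel q n G) : TypeBRel n G (1 - G 0) := by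
  refine ⟨fun i h1 h2 => (Commute.one_right _).sub_right (h.comm i h1 h2), fun h1 => ?_⟩
  have hl := h.left h1
  have hr := h.right h1
  have hq := h.hecke.quad 1 le_rfl h1
  have e1 : G 0 * (G 1 * G 1) = G 0 * ((q - 1) • G 1 + q • 1) := by rw [hq]
  have e2 : (G 1 * G 1) * G 0 = ((q - 1) • G 1 + q • 1) * G 0 := by rw [hq]
  rw [← sub_eq_zero]
  simp only [mul_add, add_mul, mul_sub, sub_mul, mul_one, one_mul, smul_mul_assoc, mul_smul_comm,
    ← mul_assoc] at *
  linear_combination (norm := module) hl - hr - e1 + e2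

theorem sub_mul_left (h : MirabolicRel q n G) (hn : 0 < n) : G 0 * subIdem q G = subIdem q G := by
  simp only [subIdem, mul_smul_comm, mul_sub, ← mul_assoc, h.idem hn]

theorem sub_mul_right (h : MirabolicRel q n G) (hn : 0 < n) : subIdem q G * G 0 = subIdem q G := by
  simp only [subIdem, smul_mul_assoc, sub_mul, mul_assoc, h.idem hn]

theorem gen_mul_sub (h : MirabolicRel q n G) (hn : 1 < n) : G 1 * subIdem q G = - subIdem q G := by
  have hr := h.right hn
  simp only [subIdem, add_mul, mul_sub, one_mul,
    mul_smul_comm, ← mul_assoc] at *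
  linear_combination (norm := module) (-q⁻¹) • hr

theorem sub_mul_gen (h : MirabolicRel q n G) (hn : 1 < n) : subIdem q G * G 1 = - subIdem q G := by
  have hr := h.left hn
  simp only [subIdem, mul_add, sub_mul, mul_one, smul_mul_assoc] at *
  linear_combination (norm := module) (-q⁻¹) • hr

theorem sub_idem (h : MirabolicRel q n G) (hq : q ≠ 0) (hn : 1 < n) :
    subIdem q G * subIdem q G = subIdem q G := by
  nth_rewrite 2 [subIdem]
  rw [mul_smul_comm, mul_sub, mul_smul_comm, ← mul_assoc, ← mul_assoc, h.sub_mul_right (by omega),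
    h.sub_mul_gen hn, neg_mul, h.sub_mul_right (by omega)]
  match_scalars
  field_simp
  ring

theorem mul_gen_mul (hq : q ≠ 0) :
    G 0 * G 1 * G 0 = (q - 1) • G 0 - q • subIdem q G := by
  rw [subIdem, smul_smul, mul_inv_cancel₀ hq, one_smul]
  abel

theorem sub_comm (h : MirabolicRel q n G) {i : ℕ} (hi : 3 ≤ i) (hn : i < n) :
    Commute (G i) (subIdem q G) := by
  have h0 := h.comm i (by omega) hn
  have h1 : Commute (G i) (G 1) := (h.hecke.commute le_rfl hi hn).symm
  exact ((h0.smul_right _).sub_right ((h0.mul_right h1).mul_right h0)).smul_right _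

theorem subGen (h : MirabolicRel q (n + 1) G) (hq : q ≠ 0) : MirabolicRel q n (subGen q G) := by
  have hs : ∀ i, 1 ≤ i → _root_.subGen q G i = G (i + 1) := fun i hi => by
    obtain ⟨j, rfl⟩ : ∃ j, i = j + 1 := ⟨i - 1, by omega⟩
    rfl
  have hs0 : _root_.subGen q G 0 = subIdem q G := rfl
  have hH := h.hecke.shift
  constructor
  · refine ⟨fun i h1 h2 => ?_, fun i h1 h2 => ?_, fun i j h1 h2 h3 => ?_⟩
    · simpa [hs i h1] using hH.quad i h1 h2
    · simpa [hs i h1, hs (i + 1) (by omega)] using hH.braid i h1 h2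
    · simpa [hs i h1, hs j (by omega)] using hH.comm i j h1 h2 h3
  · intro hn; exact h.sub_idem hq (by omega)
  · intro i h1 h2
    rw [hs i (by omega)]
    exact h.sub_comm (by omega) (by omega)
  · intro hn
    rw [hs 1 le_rfl, hs0]
    have hQ2 : subIdem q G * G 2 * subIdem q G =
        q⁻¹ • ((q - 1) • (subIdem q G * G 2) - subIdem q G * G 2 * G 1 * G 0) := by
      nth_rewrite 2 [subIdem]
      have c := (h.comm 2 le_rfl (by omega)).eq
      have e : subIdem q G * G 2 * G 0 = subIdem q G * G 2 := by
        rw [mul_assoc, c, ← mul_assoc, h.sub_mul_right (by omega)]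
      rw [mul_smul_comm, mul_sub, mul_smul_comm, ← mul_assoc, ← mul_assoc, e]
    have c := (h.comm 2 le_rfl (by omega)).eq
    have b := h.hecke.braid 1 le_rfl (by omega)
    have qd := h.hecke.quad 2 (by omega) (by omega)
    have e1 : subIdem q G * G 2 * G 1 * G 0 * G 2 = - (subIdem q G * G 2 * G 1 * G 0) := by
      rw [mul_assoc _ (G 0), ← c, ← mul_assoc, mul_assoc _ (G 1), mul_assoc _ (G 2),
        ← mul_assoc (G 2), ← b, ← mul_assoc, ← mul_assoc, h.sub_mul_gen (by omega)]
      simp only [neg_mul]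
    have e2 : subIdem q G * G 2 * G 2 = (q - 1) • (subIdem q G * G 2) + q • subIdem q G := by
      rw [mul_assoc, qd, mul_add, mul_smul_comm, mul_smul_comm, mul_one]
    rw [hQ2, mul_add, mul_one]
    simp only [sub_mul, smul_mul_assoc, e1, e2]
    match_scalars <;> field_simp <;> ring
  · intro hn
    rw [hs 1 le_rfl, hs0]
    have c := (h.comm 2 le_rfl (by omega)).eq
    have hQ2 : subIdem q G * G 2 * subIdem q G =
        q⁻¹ • ((q - 1) • (G 2 * subIdem q G) - G 0 * G 1 * G 2 * subIdem q G) := by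
      nth_rewrite 1 [subIdem]
      have e : G 0 * (G 2 * subIdem q G) = G 2 * subIdem q G := by
        rw [← mul_assoc, ← c, mul_assoc, h.sub_mul_left (by omega)]
      rw [smul_mul_assoc, smul_mul_assoc, sub_mul, sub_mul, smul_mul_assoc, smul_mul_assoc,
        mul_assoc (G 0), e, mul_assoc _ (G 2), mul_assoc _ (G 0), e, ← mul_assoc]
    have b := h.hecke.braid 1 le_rfl (by omega)
    have qd := h.hecke.quad 2 (by omega) (by omega)
    have e1 : G 2 * (G 0 * G 1 * G 2 * subIdem q G) = - (G 0 * G 1 * G 2 * subIdem q G) := by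
      simp only [← mul_assoc]
      rw [c, mul_assoc (G 0), mul_assoc (G 0), ← b]
      simp only [mul_assoc]
      rw [h.gen_mul_sub (by omega)]
      simp only [mul_neg]
    have e2 : G 2 * (G 2 * subIdem q G) = (q - 1) • (G 2 * subIdem q G) + q • subIdem q G := by
      rw [← mul_assoc, qd, add_mul, smul_mul_assoc, smul_mul_assoc, one_mul]
    rw [hQ2, add_mul, one_mul]
    simp only [mul_sub, mul_smul_comm, e1, e2]
    match_scalars <;> field_simp <;> ring

end MirabolicRel

/-- The product of the first `k` Jucys-Murphy elements. -/
def jmProd (q : ℂ) (T : ℕ → A) (p : A) : ℕ → A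
  | 0 => 1
  | k + 1 => jmProd q T p k * jm q T p k

theorem commute_jmProd_of_lt {T : ℕ → A} {p : A} (h : HeckeRel q n T) (hp : TypeBRel n T p)
    (k i : ℕ) (hk : k < i) (hi : i < n) : Commute (T i) (jmProd q T p k) := by
  induction k with
  | zero => exact Commute.one_right _
  | succ k ih => exact (ih (by omega)).mul_right (jm_commute_of_lt h hp k i (by omega) hi)

theorem commute_jmProd_of_gt {T : ℕ → A} {p : A} (h : HeckeRel q n T) (hp : TypeBRel n T p)
    (hq : q ≠ 0) (k i : ℕ) (hi : 1 ≤ i) (hik : i < k) (hk : k ≤ n) :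
    Commute (T i) (jmProd q T p k) := by
  induction k with
  | zero => omega
  | succ k ih =>
    rcases Nat.lt_or_ge i k with hlt | hge
    · exact (ih hlt (by omega)).mul_right (jm_commute_of_gt h hp k i hi hlt hk)
    · obtain ⟨j, rfl⟩ : ∃ j, k = j + 1 := ⟨k - 1, by omega⟩
      obtain rfl : i = j + 1 := by omega
      simp only [jmProd]
      rw [mul_assoc]
      exact (commute_jmProd_of_lt h hp j (j + 1) (by omega) (by omega)).mul_right
        (commute_jm_mul_jm h hp hq j (by omega))

theorem commute_base_jmProd {T : ℕ → A} {p : A} (hp : TypeBRel n T p) (k : ℕ) (hk : k ≤ n) :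
    Commute p (jmProd q T p k) := by
  induction k with
  | zero => exact Commute.one_right _
  | succ k ih => exact (ih (by omega)).mul_right (jm_commute_base hp k hk)

theorem base_mul_jmProd {T : ℕ → A} {p : A} (hp : p * p = p) (k : ℕ) (hk : 0 < k) :
    p * jmProd q T p k = jmProd q T p k := by
  induction k with
  | zero => omega
  | succ k ih =>
    rcases Nat.eq_zero_or_pos k with rfl | hk0
    · simp [jmProd, jm, hp]
    · simp only [jmProd]; rw [← mul_assoc, ih hk0]

/-- The left ideal generated by all `Q * b`; it is the two-sided ideal generated by `Q`. -/
def leftSpan {A : Type*} [Ring A] (Q : A) : Ideal A := Ideal.span (Set.range (Q * ·))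

theorem mul_mem_leftSpan {A : Type*} [Ring A] {Q x : A} (hx : x ∈ leftSpan Q) (b : A) : x * b ∈ leftSpan Q := by
  induction hx using Submodule.span_induction with
  | mem x hx =>
    obtain ⟨c, rfl⟩ := hx
    exact Ideal.subset_span ⟨c * b, (mul_assoc _ _ _).symm⟩
  | zero => rw [zero_mul]; exact zero_mem _
  | add x y _ _ hx hy => rw [add_mul]; exact add_mem hx hy
  | smul a x _ hx => rw [smul_eq_mul, mul_assoc]; exact Ideal.mul_mem_left _ a hx

theorem exists_jm_mul_sub_one_mem {T : ℕ → A} {Q : A} (h : HeckeRel q n T) (hq : q ≠ 0) (k : ℕ)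
    (hk : k < n) : ∃ u, jm q T (1 - Q) k * u - 1 ∈ leftSpan Q := by
  induction k with
  | zero =>
    refine ⟨1, ?_⟩
    have : jm q T (1 - Q) 0 * 1 - 1 = -(Q * 1) := by simp [jm]
    rw [this]
    exact neg_mem (Ideal.subset_span ⟨1, rfl⟩)
  | succ k ih =>
    obtain ⟨u, hu⟩ := ih (by omega)
    set t := q⁻¹ • (T (k + 1) - (q - 1) • (1 : A)) with ht
    have hqd := h.quad (k + 1) (by omega) hk
    have htt : T (k + 1) * t = 1 := by
      rw [ht, mul_smul_comm, mul_sub, hqd, mul_smul_comm, mul_one, add_sub_cancel_left, smul_smul,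
        inv_mul_cancel₀ hq, one_smul]
    refine ⟨q • (t * u * t), ?_⟩
    have e : jm q T (1 - Q) (k + 1) * q • (t * u * t) - 1 =
        T (k + 1) * ((jm q T (1 - Q) k * u - 1) * t) := by
      simp only [jm]
      rw [smul_mul_smul_comm, inv_mul_cancel₀ hq, one_smul, sub_mul, mul_sub, one_mul, htt]
      congr 1
      simp only [mul_assoc]
      rw [← mul_assoc (T (k + 1)) t, htt, one_mul]
    rw [e]
    exact Ideal.mul_mem_left _ _ (mul_mem_leftSpan hu _)

theorem exists_jmProd_mul_sub_one_mem {T : ℕ → A} {Q : A} (h : HeckeRel q n T) (hq : q ≠ 0) (k : ℕ)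
    (hk : k ≤ n) : ∃ u, jmProd q T (1 - Q) k * u - 1 ∈ leftSpan Q := by
  induction k with
  | zero => exact ⟨1, by simp [jmProd]⟩
  | succ k ih =>
    obtain ⟨v, hv⟩ := ih (by omega)
    obtain ⟨u, hu⟩ := exists_jm_mul_sub_one_mem (Q := Q) h hq k hk
    refine ⟨u * v, ?_⟩
    have e : jmProd q T (1 - Q) (k + 1) * (u * v) - 1 =
        jmProd q T (1 - Q) k * ((jm q T (1 - Q) k * u - 1) * v) +
          (jmProd q T (1 - Q) k * v - 1) := by
      simp only [jmProd]; noncomm_ring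
    rw [e]
    exact add_mem (Ideal.mul_mem_left _ _ (mul_mem_leftSpan hu _)) hv

end Mirabolic

section Semisimple

universe u

open Submodule in
theorem isSemisimpleModule_of_subalgebra {A M : Type*} [Ring A] [Algebra ℂ A]
    (H : Subalgebra ℂ A) [IsSemisimpleRing H] [AddCommGroup M] [Module A M]
    (hM : ∀ a : A, ∃ h ∈ H, ∀ x : M, a • x = h • x) : IsSemisimpleModule A M := by
  let e : Submodule A M ≃o Submodule H M :=
    { toFun := fun N => { N with smul_mem' := fun c _ hx => N.smul_mem (c : A) hx }
      invFun := fun N => { N with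
        smul_mem' := fun a x hx => by
          obtain ⟨h, hh, e⟩ := hM a
          rw [e]
          exact N.smul_mem (⟨h, hh⟩ : H) hx }
      left_inv := fun _ => rfl
      right_inv := fun _ => rfl
      map_rel_iff' := Iff.rfl }
  have : ComplementedLattice (Submodule H M) :=
    (isSemisimpleModule_iff H M).1 inferInstance
  exact (isSemisimpleModule_iff A M).2 e.symm.complementedLattice

/-- A compression criterion for the left ideal generated by an idempotent to be semisimple. -/
theorem isSemisimpleModule_span_idempotent {A : Type*} [Ring A] [Algebra ℂ A] {Q : A}
    (hQ : Q * Q = Q) (A' : Subalgebra ℂ A) [IsSemisimpleRing A'] (hc : ∀ a ∈ A', Commute a Q)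
    (hQA : ∀ a : A, ∃ c ∈ A', Q * a * Q = c * Q)
    (hf : ∀ x ∈ Ideal.span {Q}, (∀ b, Q * b * x = 0) → x = 0) :
    IsSemisimpleModule A (Ideal.span {Q}) := by
  have key : ∀ W : Ideal A, W ≤ Ideal.span {Q} → ∃ f ∈ W, ∀ x ∈ W, x * f = x := by
    intro W hW
    let L : Ideal A' :=
      { carrier := {a | (a : A) * Q ∈ W}
        add_mem' := fun {a b} ha hb => by
          simp only [Set.mem_ofPred_eq, Subalgebra.coe_add, add_mul] at *
          exact add_mem ha hb
        zero_mem' := by simp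
        smul_mem' := fun c x hx => by
          simp only [Set.mem_ofPred_eq, smul_eq_mul, Subalgebra.coe_mul, mul_assoc] at *
          exact W.mul_mem_left _ hx }
    obtain ⟨g, hg, hL⟩ := IsSemisimpleRing.ideal_eq_span_idempotent L
    have hgL : g ∈ L := hL ▸ Ideal.mem_span_singleton_self g
    refine ⟨g * Q, hgL, fun x hx => ?_⟩
    have hx' : x * (g * Q) - x ∈ W := sub_mem (W.mul_mem_left _ hgL) hx
    rw [← sub_eq_zero]
    refine hf _ (hW hx') fun b => ?_
    obtain ⟨y, rfl⟩ := Ideal.mem_span_singleton'.1 (hW hx)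
    obtain ⟨c, hcA, hcQ⟩ := hQA (b * y)
    have hbx : Q * b * (y * Q) = c * Q := by rw [← hcQ]; simp only [mul_assoc]
    have hcL : (⟨c, hcA⟩ : A') ∈ L := by
      change c * Q ∈ W
      rw [← hbx]
      exact W.mul_mem_left _ hx
    rw [hL] at hcL
    obtain ⟨d, hd⟩ := Ideal.mem_span_singleton'.1 hcL
    have hcg : c * g = c := by
      have : (⟨c, hcA⟩ : A') * g = ⟨c, hcA⟩ := by rw [← hd, mul_assoc, hg.eq]
      exact congrArg Subtype.val this
    rw [mul_sub, ← mul_assoc _ _ ((g : A) * Q), hbx, (hc g g.2).eq, mul_assoc, ← mul_assoc Q Q, hQ,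
      ← (hc g g.2).eq, ← mul_assoc, hcg, sub_self]
  refine (isSemisimpleModule_iff A _).2 ⟨fun W => ?_⟩
  obtain ⟨f, hf, hWf⟩ := key (W.map (Submodule.subtype _)) (Submodule.map_subtype_le _ _)
  obtain ⟨f, hfW, rfl⟩ := hf
  let proj : Ideal.span {Q} →ₗ[A] W :=
    { toFun := fun x => ⟨(x : A) • f, W.smul_mem _ hfW⟩
      map_add' := fun x y => by ext; simp [add_mul]
      map_smul' := fun a x => by ext; simp [mul_assoc] }
  refine ⟨LinearMap.ker proj, LinearMap.isCompl_of_proj fun x => ?_⟩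
  ext
  exact hWf _ ⟨x, x.2, rfl⟩

open Submodule Subalgebra in
theorem compression_mem {A : Type*} [Ring A] [Algebra ℂ A] {Q : A} (hQ : Q * Q = Q)
    {H A' : Subalgebra ℂ A} {s : Set A} (hs : Algebra.adjoin ℂ s = ⊤) (hsH : ∀ x ∈ s, x = Q ∨ x ∈ H)
    (hc : ∀ a ∈ A', Commute a Q)
    (hH : span ℂ {Q} * toSubmodule H * span ℂ {Q} ≤ toSubmodule A' * span ℂ {Q}) (a : A) :
    ∃ c ∈ A', Q * a * Q = c * Q := by
  set S := span ℂ {Q} with hS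
  set B := toSubmodule A' with hB
  set K := toSubmodule H with hK
  have hSS : S * S = S := by rw [hS, span_mul_span, Set.singleton_mul_singleton, hQ]
  have hSB : S * B = B * S := by
    apply le_antisymm
    · refine mul_le.2 fun x hx y hy => ?_
      obtain ⟨r, rfl⟩ := mem_span_singleton.1 hx
      rw [smul_mul_assoc, ← (hc y hy).eq, ← mul_smul_comm]
      exact mul_mem_mul hy hx
    · refine mul_le.2 fun y hy x hx => ?_
      obtain ⟨r, rfl⟩ := mem_span_singleton.1 hx
      rw [mul_smul_comm, (hc y hy).eq, ← smul_mul_assoc]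
      exact mul_mem_mul hx hy
  have hBB : B * B = B := (isIdempotentElem_toSubmodule A').eq
  have hKK : K * K = K := (isIdempotentElem_toSubmodule H).eq
  have hQS : Q ∈ S := mem_span_singleton_self Q
  have h1 : S * (K * B * S) ≤ B * S := by
    calc S * (K * B * S) = S * K * S * B := by simp only [mul_assoc, hSB]
      _ ≤ B * S * B := mul_le_mul_left hH B
      _ = B * S := by rw [mul_assoc, hSB, ← mul_assoc, hBB]
  have h2 : B * S ≤ K * B * S := by
    have : 1 ≤ K := one_le.2 H.one_mem
    calc B * S = 1 * B * S := by rw [one_mul]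
      _ ≤ K * B * S := by gcongr
  have h3 : ∀ a : A, a * Q ∈ K * B * S := by
    intro a
    have ha : a ∈ Algebra.adjoin ℂ s := hs ▸ Algebra.mem_top
    suffices ∀ x ∈ K * B * S, a * x ∈ K * B * S by
      refine this Q (h2 ?_)
      simpa using mul_mem_mul (show (1 : A) ∈ B from A'.one_mem) hQS
    induction ha using Algebra.adjoin_induction with
    | mem y hy =>
      intro x hx
      rcases hsH y hy with rfl | hyH
      · exact h2 (h1 (mul_mem_mul hQS hx))
      · rw [mul_assoc] at hx ⊢
        rw [← hKK, mul_assoc]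
        exact mul_mem_mul hyH hx
    | algebraMap r =>
      intro x hx
      rw [← Algebra.smul_def]
      exact smul_mem _ r hx
    | add y z _ _ hy hz => intro x hx; rw [add_mul]; exact add_mem (hy x hx) (hz x hx)
    | mul y z _ _ hy hz => intro x hx; rw [mul_assoc y]; exact hy _ (hz x hx)
  have h4 := h1 (mul_mem_mul hQS (h3 a))
  rw [hS, mem_mul_span_singleton] at h4
  obtain ⟨c, hcA, e⟩ := h4
  exact ⟨c, hcA, by rw [mul_assoc, e]⟩

theorem isSemisimpleRing_of_leftSpan {A : Type*} [Ring A] {Q Z u : A} (hZ : ∀ a, Commute Z a)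
    (hu : Z * u - 1 ∈ leftSpan Q) (h1 : IsSemisimpleModule A (Ideal.span {Z}))
    (h2 : IsSemisimpleModule A (Ideal.span {Q})) : IsSemisimpleRing A := by
  let p : Option A → Submodule A A
    | none => Ideal.span {Z}
    | some b => Ideal.span {Q * b}
  refine isSemisimpleModule_of_isSemisimpleModule_submodule' (p := p) (fun i => ?_) ?_
  · cases i with
    | none => exact h1
    | some b =>
      have : p (some b) = LinearMap.range ((LinearMap.toSpanSingleton A A b).comp
          (Submodule.subtype (Ideal.span {Q}))) := by
        rw [LinearMap.range_comp, Submodule.range_subtype, Ideal.span, Submodule.map_span]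
        simp [p, Ideal.span]
      rw [this]
      exact IsSemisimpleModule.range _
  · rw [Ideal.eq_top_iff_one]
    have e : (1 : A) = u * Z - (Z * u - 1) := by rw [(hZ u).eq]; abel
    rw [e]
    refine sub_mem (Submodule.mem_iSup_of_mem none ?_) ?_
    · exact Ideal.mem_span_singleton'.2 ⟨u, rfl⟩
    · refine (Ideal.span_le.2 ?_ : leftSpan Q ≤ ⨆ i, p i) hu
      rintro _ ⟨b, rfl⟩
      exact Submodule.mem_iSup_of_mem (some b) (Ideal.mem_span_singleton_self _)

end Semisimple

section MirabolicSemisimple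

universe u

variable {A : Type u} [Ring A] [Algebra ℂ A] {q : ℂ} {n : ℕ} {G : ℕ → A}

open Submodule Subalgebra in
theorem HeckeRel.compression_le (h : HeckeRel q n G) {A' : Subalgebra ℂ A} {Q : A}
    (hQ : Q * Q = Q) (hc : ∀ a ∈ A', Commute a Q) (hA : ∀ i, 2 ≤ i → i < n → G i ∈ A')
    (h1 : 1 < n → ∃ a ∈ A', Q * G 1 * Q = a * Q) :
    span ℂ {Q} * toSubmodule (Algebra.adjoin ℂ (G '' Set.Ico 1 n)) * span ℂ {Q} ≤
      toSubmodule A' * span ℂ {Q} := by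
  have hA1 : (1 : A) ∈ toSubmodule A' := A'.one_mem
  have hQS : Q ∈ span ℂ {Q} := mem_span_singleton_self Q
  rcases Nat.lt_or_ge 1 n with hn | hn
  · obtain ⟨a, haA, ha⟩ := h1 hn
    refine (mul_le_mul_left (mul_le_mul_right h.adjoin_le _) _).trans ?_
    have hK : toSubmodule (Algebra.adjoin ℂ (G '' Set.Ico 2 n)) ≤ toSubmodule A' := by
      rw [toSubmodule.le_iff_le, Algebra.adjoin_le_iff]
      rintro _ ⟨i, hi, rfl⟩
      exact hA i hi.1 hi.2
    refine (mul_le_mul_left (mul_le_mul_right (mul_le_mul' (mul_le_mul_left hK _) hK) _) _).trans ?_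
    set S := span ℂ {Q} with hS
    set B := toSubmodule A' with hB
    have hSB : S * B = B * S := by
      apply le_antisymm
      · refine mul_le.2 fun x hx y hy => ?_
        obtain ⟨r, rfl⟩ := mem_span_singleton.1 hx
        rw [smul_mul_assoc, ← (hc y hy).eq, ← mul_smul_comm]
        exact mul_mem_mul hy hx
      · refine mul_le.2 fun y hy x hx => ?_
        obtain ⟨r, rfl⟩ := mem_span_singleton.1 hx
        rw [mul_smul_comm, (hc y hy).eq, ← smul_mul_assoc]
        exact mul_mem_mul hx hy
    have hBB : B * B = B := (isIdempotentElem_toSubmodule A').eq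
    have hX : S * span ℂ {1, G 1} * S ≤ B * S := by
      rw [hS, span_mul_span, span_mul_span, span_le]
      rintro _ ⟨_, ⟨x, hx, y, hy, rfl⟩, z, hz, rfl⟩
      obtain rfl := Set.mem_singleton_iff.1 hx
      obtain rfl := Set.mem_singleton_iff.1 hz
      rcases hy with hy | hy
      · rw [hy]
        simpa [hQ] using mul_mem_mul hA1 hQS
      · rw [hy]
        change z * G 1 * z ∈ _
        rw [ha]
        exact mul_mem_mul haA hQS
    calc S * (B * span ℂ {1, G 1} * B) * S = B * (S * span ℂ {1, G 1} * S) * B := by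
          rw [← mul_assoc S, ← mul_assoc S, mul_assoc _ B S, ← hSB, hSB]
          simp only [mul_assoc]
          rw [hSB]
      _ ≤ B * (B * S) * B := by gcongr
      _ = B * S := by rw [← mul_assoc, hBB, mul_assoc, hSB, ← mul_assoc, hBB]
  · rw [Set.Ico_eq_empty (by omega), Set.image_empty, Algebra.adjoin_empty]
    rw [Algebra.toSubmodule_bot, mul_one, span_mul_span, Set.singleton_mul_singleton, hQ]
    simpa using mul_le_mul_left (one_le.2 hA1) (span ℂ {Q})

namespace MirabolicRel

theorem isSemisimpleRing_of_corner (h : MirabolicRel q n G) (hq : q ≠ 0) (hn : 0 < n)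
    (hg : ∀ k, 1 ≤ k → k ≤ n → ∑ j ∈ Finset.range k, q ^ j ≠ 0)
    (hT : Algebra.adjoin ℂ (G '' Set.Iio n) = ⊤) (A' : Subalgebra ℂ A) [IsSemisimpleRing A']
    (hc : ∀ a ∈ A', Commute a (G 0)) (hA : ∀ i, 2 ≤ i → i < n → G i ∈ A')
    (h1 : 1 < n → ∃ a ∈ A', G 0 * G 1 * G 0 = a * G 0) : IsSemisimpleRing A := by
  have hQ := h.idem hn
  have hpp : (1 - G 0) * (1 - G 0) = 1 - G 0 := (IsIdempotentElem.one_sub hQ).eq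
  set Z := jmProd q G (1 - G 0) n with hZ
  have hQZ : G 0 * Z = 0 := by
    have := base_mul_jmProd (q := q) (T := G) hpp n hn
    rw [sub_mul, one_mul, sub_eq_self] at this
    exact this
  have hZgen : ∀ x ∈ G '' Set.Iio n, Commute x Z := by
    rintro _ ⟨i, hi, rfl⟩
    rcases Nat.eq_zero_or_pos i with rfl | hi0
    · have := (Commute.one_left Z).sub_left (commute_base_jmProd (q := q) h.typeBRel n le_rfl)
      rwa [sub_sub_cancel] at this
    · exact commute_jmProd_of_gt h.hecke h.typeBRel hq n i hi0 hi le_rfl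
  have hZc : ∀ a, Commute Z a := fun a => (commute_of_adjoin_eq_top hT hZgen a).symm
  obtain ⟨u, hu⟩ := exists_jmProd_mul_sub_one_mem (Q := G 0) h.hecke hq n le_rfl
  refine isSemisimpleRing_of_leftSpan hZc hu ?_ ?_
  · set H := Algebra.adjoin ℂ (G '' Set.Ico 1 n) with hH
    have : IsSemisimpleRing H :=
      (h.hecke.restrictGen (I := Set.Ico 1 n) le_rfl).isSemisimpleRing hq n hg
        (adjoin_restrictGen G _)
    refine isSemisimpleModule_of_subalgebra H fun a => ?_
    have ha : a ∈ Algebra.adjoin ℂ (G '' Set.Iio n) := hT ▸ Algebra.mem_top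
    induction ha using Algebra.adjoin_induction with
    | mem y hy =>
      obtain ⟨i, hi, rfl⟩ := hy
      rcases Nat.eq_zero_or_pos i with rfl | hi0
      · refine ⟨0, zero_mem _, fun x => Subtype.ext ?_⟩
        obtain ⟨b, hb⟩ := Ideal.mem_span_singleton'.1 x.2
        change G 0 * (x : A) = 0 * (x : A)
        rw [← hb, ← (hZc b).eq, ← mul_assoc, hQZ, zero_mul, zero_mul]
      · exact ⟨G i, Algebra.subset_adjoin ⟨i, ⟨hi0, hi⟩, rfl⟩, fun x => rfl⟩
    | algebraMap r => exact ⟨_, H.algebraMap_mem r, fun x => rfl⟩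
    | add y z _ _ hy hz =>
      obtain ⟨a, ha, ea⟩ := hy
      obtain ⟨b, hb, eb⟩ := hz
      exact ⟨a + b, add_mem ha hb, fun x => by rw [add_smul, add_smul, ea, eb]⟩
    | mul y z _ _ hy hz =>
      obtain ⟨a, ha, ea⟩ := hy
      obtain ⟨b, hb, eb⟩ := hz
      exact ⟨a * b, mul_mem ha hb, fun x => by rw [mul_smul, mul_smul, ea, eb]⟩
  · refine isSemisimpleModule_span_idempotent hQ A' hc
      (compression_mem hQ (H := Algebra.adjoin ℂ (G '' Set.Ico 1 n)) hT ?_ hc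
        (h.hecke.compression_le hQ hc hA h1)) fun x hx hx0 => ?_
    · rintro _ ⟨i, hi, rfl⟩
      rcases Nat.eq_zero_or_pos i with rfl | hi0
      · exact Or.inl rfl
      · exact Or.inr (Algebra.subset_adjoin ⟨i, ⟨hi0, hi⟩, rfl⟩)
    · obtain ⟨y, rfl⟩ := Ideal.mem_span_singleton'.1 hx
      have hZx : Z * (y * G 0) = 0 := by
        rw [(hZc _).eq, mul_assoc, hQZ, mul_zero]
      have hk : ∀ v ∈ leftSpan (G 0), v * (y * G 0) = 0 := by
        intro v hv
        induction hv using Submodule.span_induction with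
        | mem v hv => obtain ⟨b, rfl⟩ := hv; exact hx0 b
        | zero => rw [zero_mul]
        | add v w _ _ hv hw => rw [add_mul, hv, hw, add_zero]
        | smul a v _ hv => rw [smul_eq_mul, mul_assoc, hv, mul_zero]
      have := hk _ hu
      rwa [sub_mul, one_mul, (hZc u).eq, mul_assoc, hZx, mul_zero, zero_sub, neg_eq_zero] at this

theorem isSemisimpleRing (hq : q ≠ 0) (n : ℕ)
    (hg : ∀ k, 1 ≤ k → k ≤ n → ∑ j ∈ Finset.range k, q ^ j ≠ 0) {A : Type u} [Ring A]
    [Algebra ℂ A] {G : ℕ → A} (h : MirabolicRel q n G)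
    (hT : Algebra.adjoin ℂ (G '' Set.Iio n) = ⊤) : IsSemisimpleRing A := by
  induction n generalizing A with
  | zero =>
    refine isSemisimpleRing_of_adjoin_empty ?_
    rw [← hT]
    simp
  | succ n ih =>
    have hS := h.subGen hq
    have : IsSemisimpleRing (Algebra.adjoin ℂ (_root_.subGen q G '' Set.Iio n)) :=
      ih (fun k h1 h2 => hg k h1 (by omega)) hS.restrictGen (adjoin_restrictGen _ _)
    refine h.isSemisimpleRing_of_corner hq (by omega) hg hT
      (Algebra.adjoin ℂ (_root_.subGen q G '' Set.Iio n)) (fun a ha => ?_) (fun i h2 hi => ?_)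
      fun h1 => ?_
    · refine commute_of_mem_adjoin (fun x hx => ?_) ha
      obtain ⟨i, hi, rfl⟩ := hx
      cases i with
      | zero =>
        exact (h.sub_mul_right (by omega)).trans (h.sub_mul_left (by omega)).symm
      | succ i => exact h.comm (i + 2) (by omega) (by rw [Set.mem_Iio] at hi; omega)
    · obtain ⟨j, rfl⟩ : ∃ j, i = j + 2 := ⟨i - 2, by omega⟩
      exact Algebra.subset_adjoin ⟨j + 1, by rw [Set.mem_Iio]; omega, rfl⟩
    · refine ⟨(q - 1) • 1 - q • subIdem q G, sub_mem (Subalgebra.smul_mem _ (one_mem _) _)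
        (Subalgebra.smul_mem _ (Algebra.subset_adjoin (s := _root_.subGen q G '' Set.Iio n)
          ⟨0, Set.mem_Iio.2 (by omega), rfl⟩) _), ?_⟩
      rw [mul_gen_mul hq, sub_mul, smul_mul_assoc, smul_mul_assoc, one_mul,
        h.sub_mul_right (by omega)]

end MirabolicRel

end MirabolicSemisimple

section Symmetrizer

/-- The sum `1 + T_k + T_{k-1} T_k + ⋯ + T_1 ⋯ T_k`. -/
def cosetSum {A : Type*} [Ring A] (T : ℕ → A) : ℕ → A
  | 0 => 1
  | k + 1 => 1 + cosetSum T k * T (k + 1)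

/-- The sum of the standard basis of the Hecke algebra generated by `T_1, …, T_{k-1}`. -/
def symmetrizer {A : Type*} [Ring A] (T : ℕ → A) : ℕ → A
  | 0 => 1
  | k + 1 => cosetSum T k * symmetrizer T k

section

variable {A B : Type*} [Ring A] [Ring B]

theorem map_cosetSum (φ : A →+* B) {T : ℕ → A} {S : ℕ → B} {n : ℕ}
    (h : ∀ i, 1 ≤ i → i < n → φ (T i) = S i) (k : ℕ) (hk : k < n) :
    φ (cosetSum T k) = cosetSum S k := by
  induction k with
  | zero => exact map_one φ
  | succ k ih => simp only [cosetSum, map_add, map_one, map_mul, ih (by omega), h _ le_add_self hk]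

theorem map_symmetrizer (φ : A →+* B) {T : ℕ → A} {S : ℕ → B} {n : ℕ}
    (h : ∀ i, 1 ≤ i → i < n → φ (T i) = S i) (k : ℕ) (hk : k ≤ n) :
    φ (symmetrizer T k) = symmetrizer S k := by
  induction k with
  | zero => exact map_one φ
  | succ k ih => simp only [symmetrizer, map_mul, ih (by omega), map_cosetSum φ h k hk]

end

variable {A : Type*} [Ring A] [Algebra ℂ A] {q : ℂ} {n : ℕ} {T : ℕ → A}

theorem commute_cosetSum (h : HeckeRel q n T) (k i : ℕ) (hk : k + 2 ≤ i) (hi : i < n) :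
    Commute (T i) (cosetSum T k) := by
  induction k with
  | zero => exact Commute.one_right _
  | succ k ih =>
    exact (Commute.one_right _).add_right
      ((ih (by omega)).mul_right (h.commute (i := k + 1) (j := i) le_add_self (by omega) hi).symm)

theorem mul_cosetSum_mul (h : HeckeRel q n T) (k : ℕ) (hk : k < n) (v : A)
    (hv : ∀ i, 1 ≤ i → i < k → T i * v = q • v) (i : ℕ) (hi : 1 ≤ i) (hik : i ≤ k) :
    T i * (cosetSum T k * v) = q • (cosetSum T k * v) := by
  induction k generalizing v i with
  | zero => omega
  | succ k ih =>
    rcases Nat.lt_or_ge i (k + 1) with hlt | hge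
    · simp only [cosetSum]
      rw [add_mul, one_mul, mul_add, hv i hi hlt, mul_assoc, smul_add, ih (by omega) _ _ i hi
        (by omega)]
      intro j h1 h2
      rw [← mul_assoc, (h.commute h1 (by omega) hk).eq, mul_assoc, hv j h1 (by omega),
        mul_smul_comm]
    · obtain rfl : i = k + 1 := by omega
      have hqd := h.quad (k + 1) hi hk
      cases k with
      | zero =>
        simp only [cosetSum, one_mul, zero_add] at *
        rw [← mul_assoc, mul_add, hqd, mul_one, ← smul_mul_assoc]
        congr 1
        module
      | succ k =>
        have hc := commute_cosetSum h k (k + 2) le_rfl hk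
        have hb := h.braid (k + 1) le_add_self hk
        have e1 : T (k + 2) * (cosetSum T k * T (k + 1) * T (k + 2) * v) =
            q • (cosetSum T k * T (k + 1) * T (k + 2) * v) := by
          rw [← mul_assoc, ← mul_assoc, ← mul_assoc, hc.eq, mul_assoc (cosetSum T k),
            mul_assoc (cosetSum T k), ← hb, ← mul_assoc, ← mul_assoc, mul_assoc _ _ v,
            hv (k + 1) le_add_self (by omega), mul_smul_comm]
        have e2 : T (k + 2) * (v + T (k + 2) * v) = q • (v + T (k + 2) * v) := by
          rw [mul_add, ← mul_assoc, hqd, add_mul, smul_mul_assoc, smul_mul_assoc, one_mul]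
          module
        have e3 : cosetSum T (k + 2) * v =
            v + T (k + 2) * v + cosetSum T k * T (k + 1) * T (k + 2) * v := by
          simp only [cosetSum]
          noncomm_ring
        rw [e3, mul_add, e1, e2, ← smul_add]

theorem mul_symmetrizer (h : HeckeRel q n T) (k : ℕ) (hk : k ≤ n) (i : ℕ) (hi : 1 ≤ i)
    (hik : i < k) : T i * symmetrizer T k = q • symmetrizer T k := by
  induction k generalizing i with
  | zero => omega
  | succ k ih =>
    exact mul_cosetSum_mul h k hk _ (fun j h1 h2 => ih (by omega) j h1 h2) i hi (by omega)

theorem cosetSum_mul {v : A} (k : ℕ) (hv : ∀ i, 1 ≤ i → i ≤ k → T i * v = q • v) :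
    cosetSum T k * v = (∑ j ∈ Finset.range (k + 1), q ^ j) • v := by
  induction k with
  | zero => simp [cosetSum]
  | succ k ih =>
    simp only [cosetSum]
    rw [add_mul, one_mul, mul_assoc, hv (k + 1) le_add_self le_rfl, mul_smul_comm,
      ih fun i h1 h2 => hv i h1 (by omega), geom_sum_succ (n := k + 1), smul_smul, add_smul,
      one_smul, add_comm]

theorem symmetrizer_mul {v : A} (k : ℕ) (hv : ∀ i, 1 ≤ i → i < k → T i * v = q • v) :
    symmetrizer T k * v = (∏ j ∈ Finset.Icc 1 k, ∑ j ∈ Finset.range j, q ^ j) • v := by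
  induction k with
  | zero => simp [symmetrizer]
  | succ k ih =>
    simp only [symmetrizer]
    rw [mul_assoc, ih fun i h1 h2 => hv i h1 (by omega), mul_smul_comm,
      cosetSum_mul k fun i h1 h2 => hv i h1 (by omega), smul_smul,
      Finset.prod_Icc_succ_top le_add_self]

end Symmetrizer

theorem eq_zero_of_isSemisimpleRing {R E : Type*} [Ring R] [Ring E] [Algebra ℂ E]
    [IsSemisimpleRing R] (φ : R →+* E) (x : R) (hs : ∀ s, ∃ c : ℂ, φ s * φ x = c • φ x)
    (hx : φ x * φ x = 0) : φ x = 0 := by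
  obtain ⟨e, he, hI⟩ := IsSemisimpleRing.ideal_eq_span_idempotent (Ideal.span {x})
  obtain ⟨s, hs'⟩ := Ideal.mem_span_singleton'.1 (hI ▸ Ideal.mem_span_singleton_self e :
    e ∈ Ideal.span {x})
  obtain ⟨t, ht⟩ := Ideal.mem_span_singleton'.1 (hI ▸ Ideal.mem_span_singleton_self x :
    x ∈ Ideal.span {e})
  obtain ⟨c, hc⟩ := hs s
  have h1 : φ e = c • φ x := by rw [← hs', map_mul, hc]
  have h2 : φ e = 0 := by
    rw [← he.eq, map_mul, h1, smul_mul_smul_comm, hx, smul_zero]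
  rw [← ht, map_mul, h2, mul_zero]

section PermRep

open Equiv

/-- The operator `T_i` on the right regular representation of the Hecke algebra, acting on the
positions `i`, `i + 1` of permutations of `ℕ`. -/
def heckeOp (q : ℂ) (i : ℕ) : Module.End ℂ (Perm ℕ →₀ ℂ) :=
  Finsupp.linearCombination ℂ fun w =>
    if w i < w (i + 1) then Finsupp.single (w * swap i (i + 1)) 1
    else q • Finsupp.single (w * swap i (i + 1)) 1 + (q - 1) • Finsupp.single w 1

variable {q : ℂ}

theorem heckeOp_single (i : ℕ) (w : Perm ℕ) :
    heckeOp q i (Finsupp.single w 1) =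
      if w i < w (i + 1) then Finsupp.single (w * swap i (i + 1)) 1
      else q • Finsupp.single (w * swap i (i + 1)) 1 + (q - 1) • Finsupp.single w 1 := by
  simp only [heckeOp, Finsupp.linearCombination_single, one_smul]

theorem heckeOp_ext {f g : Module.End ℂ (Perm ℕ →₀ ℂ)}
    (h : ∀ w, f (Finsupp.single w 1) = g (Finsupp.single w 1)) : f = g :=
  Finsupp.lhom_ext' fun w => LinearMap.ext_ring (h w)

theorem heckeRel_heckeOp (q : ℂ) (n : ℕ) : HeckeRel q n (heckeOp q) := by
  refine ⟨fun i _ _ => heckeOp_ext fun w => ?_, fun i _ _ => heckeOp_ext fun w => ?_,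
    fun i j _ h2 _ => heckeOp_ext fun w => ?_⟩
  · rcases lt_or_gt_of_ne (w.injective.ne (Nat.succ_ne_self i)) with h | h <;>
      simp only [Nat.succ_eq_add_one] at h <;>
      simp only [heckeOp_single, Module.End.mul_apply, LinearMap.add_apply, LinearMap.smul_apply,
        Module.End.one_apply, map_add, map_smul, Perm.mul_apply, swap_apply_left, swap_apply_right,
        h, h.not_gt, if_true, if_false, mul_assoc, swap_mul_self, mul_one] <;>
      module
  · have a1 : swap i (i + 1) (i + 2) = i + 2 := swap_apply_of_ne_of_ne (by omega) (by omega)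
    have a2 : swap (i + 1) (i + 2) i = i := swap_apply_of_ne_of_ne (by omega) (by omega)
    have hb : swap i (i + 1) * (swap (i + 1) (i + 2) * swap i (i + 1)) =
        swap (i + 1) (i + 2) * (swap i (i + 1) * swap (i + 1) (i + 2)) := by
      have h1 := swap_mul_swap_mul_swap (x := i + 2) (y := i + 1) (z := i) (by omega) (by omega)
      have h2 := swap_mul_swap_mul_swap (x := i) (y := i + 1) (z := i + 2) (by omega) (by omega)
      rw [swap_comm (i + 1) i, swap_comm (i + 2) (i + 1)] at h1
      rw [← mul_assoc, ← mul_assoc, h1, h2, swap_comm]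
    have h01 : w i < w (i + 1) ∨ w (i + 1) < w i := lt_or_gt_of_ne (w.injective.ne (by omega))
    have h02 : w i < w (i + 2) ∨ w (i + 2) < w i := lt_or_gt_of_ne (w.injective.ne (by omega))
    have h12 : w (i + 1) < w (i + 2) ∨ w (i + 2) < w (i + 1) :=
      lt_or_gt_of_ne (w.injective.ne (by omega))
    rcases h01 with h01 | h01 <;> rcases h02 with h02 | h02 <;> rcases h12 with h12 | h12 <;>
      first
      | omega
      | simp only [heckeOp_single, Module.End.mul_apply, map_add, map_smul, Perm.mul_apply,
          swap_apply_left, swap_apply_right, a1, a2, h01, h02, h12, h01.not_gt, h02.not_gt,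
          h12.not_gt, if_true, if_false, mul_assoc, swap_mul_self, mul_one, hb, add_assoc,
          Nat.reduceAdd]
        try module
  · have a1 : swap i (i + 1) j = j := swap_apply_of_ne_of_ne (by omega) (by omega)
    have a2 : swap i (i + 1) (j + 1) = j + 1 := swap_apply_of_ne_of_ne (by omega) (by omega)
    have a3 : swap j (j + 1) i = i := swap_apply_of_ne_of_ne (by omega) (by omega)
    have a4 : swap j (j + 1) (i + 1) = i + 1 := swap_apply_of_ne_of_ne (by omega) (by omega)
    have hb : swap i (i + 1) * swap j (j + 1) = swap j (j + 1) * swap i (i + 1) := by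
      ext x
      simp only [Perm.mul_apply, swap_apply_def]
      grind
    by_cases hi : w i < w (i + 1) <;> by_cases hj : w j < w (j + 1) <;>
      simp only [heckeOp_single, Module.End.mul_apply, map_add, map_smul, Perm.mul_apply, a1, a2,
        a3, a4, hi, hj, if_true, if_false, mul_assoc, hb]
    module

theorem heckeOp_mem_supported {s : Set (Perm ℕ)} {i : ℕ} (hs : ∀ w ∈ s, w * swap i (i + 1) ∈ s)
    {v : Perm ℕ →₀ ℂ} (hv : v ∈ Finsupp.supported ℂ ℂ s) :
    heckeOp q i v ∈ Finsupp.supported ℂ ℂ s := by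
  rw [Finsupp.supported_eq_span_single] at hv
  induction hv using Submodule.span_induction with
  | mem v hv =>
    obtain ⟨w, hw, rfl⟩ := hv
    have h1 := Finsupp.single_mem_supported ℂ (1 : ℂ) hw
    have h2 := Finsupp.single_mem_supported ℂ (1 : ℂ) (hs w hw)
    rw [heckeOp_single]
    split_ifs
    · exact h2
    · exact add_mem (Submodule.smul_mem _ _ h2) (Submodule.smul_mem _ _ h1)
  | zero => rw [map_zero]; exact zero_mem _
  | add x y _ _ hx hy => rw [map_add]; exact add_mem hx hy
  | smul c x _ hx => rw [map_smul]; exact Submodule.smul_mem _ _ hx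

theorem cosetSum_mem_supported {s : Set (Perm ℕ)} (k : ℕ)
    (hs : ∀ i ≤ k, ∀ w ∈ s, w * swap i (i + 1) ∈ s) {v : Perm ℕ →₀ ℂ}
    (hv : v ∈ Finsupp.supported ℂ ℂ s) :
    cosetSum (heckeOp q) k v ∈ Finsupp.supported ℂ ℂ s := by
  induction k generalizing v with
  | zero => exact hv
  | succ k ih =>
    exact add_mem hv (ih (fun i hi => hs i (by omega)) (heckeOp_mem_supported (hs _ le_rfl) hv))

theorem heckeOp_mem_supported_ne (k : ℕ) {v : Perm ℕ →₀ ℂ}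
    (hv : v ∈ Finsupp.supported ℂ ℂ {w | ∀ j, k < j → w j = j}) :
    heckeOp q k v ∈ Finsupp.supported ℂ ℂ {w | w (k + 1) ≠ k + 1} := by
  rw [Finsupp.supported_eq_span_single] at hv
  induction hv using Submodule.span_induction with
  | mem v hv =>
    obtain ⟨w, hw, rfl⟩ := hv
    have h1 : w (k + 1) = k + 1 := hw _ (by omega)
    have h2 : w k < k + 1 := by
      by_contra! h
      have h3 : w (w k) = w k := hw _ (by omega)
      have := w.injective h3
      omega
    rw [heckeOp_single, if_pos (by omega)]
    refine Finsupp.single_mem_supported ℂ (1 : ℂ) ?_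
    simpa using h2.ne
  | zero => rw [map_zero]; exact zero_mem _
  | add x y _ _ hx hy => rw [map_add]; exact add_mem hx hy
  | smul c x _ hx => rw [map_smul]; exact Submodule.smul_mem _ _ hx

theorem symmetrizer_mem_supported (k : ℕ) :
    symmetrizer (heckeOp q) k (Finsupp.single 1 1) ∈
      Finsupp.supported ℂ ℂ {w : Perm ℕ | ∀ j, k < j → w j = j} := by
  induction k with
  | zero => exact Finsupp.single_mem_supported ℂ (1 : ℂ) fun j _ => rfl
  | succ k ih =>
    have hs : {w : Perm ℕ | ∀ j, k < j → w j = j} ⊆ {w | ∀ j, k + 1 < j → w j = j} :=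
      fun w hw j hj => hw j (by omega)
    refine cosetSum_mem_supported (s := {w | ∀ j, k + 1 < j → w j = j}) k (fun i hi w hw => ?_)
      (Finsupp.supported_mono hs ih)
    intro j hj
    rw [Perm.mul_apply, swap_apply_of_ne_of_ne (by omega) (by omega), hw j hj]

theorem symmetrizer_single_one (k : ℕ) :
    symmetrizer (heckeOp q) k (Finsupp.single 1 1) 1 = 1 := by
  induction k with
  | zero => exact Finsupp.single_eq_same
  | succ k ih =>
    cases k with
    | zero => exact ih
    | succ k =>
      have h : cosetSum (heckeOp q) k
          (heckeOp q (k + 1) (symmetrizer (heckeOp q) (k + 1) (Finsupp.single 1 1))) ∈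
            Finsupp.supported ℂ ℂ {w : Perm ℕ | w (k + 2) ≠ k + 2} := by
        refine cosetSum_mem_supported k (fun i hi w hw => ?_)
          (heckeOp_mem_supported_ne _ (symmetrizer_mem_supported _))
        change (w * swap i (i + 1)) (k + 2) ≠ k + 2
        rw [Perm.mul_apply, swap_apply_of_ne_of_ne (by omega) (by omega)]
        exact hw
      have h1 := Finsupp.notMem_support_iff.1 fun hm : (1 : Perm ℕ) ∈ _ =>
        (Finsupp.mem_supported _ _).1 h hm rfl
      change _ + cosetSum (heckeOp q) k (heckeOp q (k + 1) _) 1 = _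
      rw [h1, add_zero]
      exact ih

theorem symmetrizer_heckeOp_ne_zero (k : ℕ) : symmetrizer (heckeOp q) k ≠ 0 := fun h => by
  simpa [h] using symmetrizer_single_one (q := q) k

end PermRep

/-- If the Poincaré polynomial vanishes at `q`, no semisimple algebra generated by `G` can act
through the regular representation of the Hecke algebra. -/
theorem not_isSemisimpleRing_of_map_heckeOp {R : Type*} [Ring R] [Algebra ℂ R] {q : ℂ} {n : ℕ}
    {G : ℕ → R} (hG : Algebra.adjoin ℂ (G '' Set.Iio n) = ⊤)
    (φ : R →ₐ[ℂ] Module.End ℂ (Equiv.Perm ℕ →₀ ℂ)) (h0 : φ (G 0) = 0)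
    (hφ : ∀ i, 1 ≤ i → i < n → φ (G i) = heckeOp q i)
    (hq : ∏ k ∈ Finset.Icc 1 n, ∑ j ∈ Finset.range k, q ^ j = 0) : ¬ IsSemisimpleRing R := by
  intro hR
  have hH := heckeRel_heckeOp q n
  have hx : φ (symmetrizer G n) = symmetrizer (heckeOp q) n :=
    map_symmetrizer (φ : R →+* Module.End ℂ (Equiv.Perm ℕ →₀ ℂ)) (T := G) (S := heckeOp q) hφ n le_rfl
  have hT := mul_symmetrizer hH n le_rfl
  refine symmetrizer_heckeOp_ne_zero (q := q) n ?_
  rw [← hx]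
  refine eq_zero_of_isSemisimpleRing (E := Module.End ℂ (Equiv.Perm ℕ →₀ ℂ))
    (φ : R →+* Module.End ℂ (Equiv.Perm ℕ →₀ ℂ)) (symmetrizer G n) (fun s => ?_) ?_
  · have hs : s ∈ Algebra.adjoin ℂ (G '' Set.Iio n) := hG ▸ Algebra.mem_top
    change ∃ c : ℂ, φ s * φ _ = c • φ _
    rw [hx]
    induction hs using Algebra.adjoin_induction with
    | mem y hy =>
      obtain ⟨i, hi, rfl⟩ := hy
      rcases Nat.eq_zero_or_pos i with rfl | hi0
      · exact ⟨0, by rw [h0, zero_mul, zero_smul]⟩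
      · exact ⟨q, by rw [hφ i hi0 hi, hT i hi0 hi]⟩
    | algebraMap r => exact ⟨r, by rw [AlgHom.commutes, ← Algebra.smul_def]⟩
    | add y z _ _ hy hz =>
      obtain ⟨a, ha⟩ := hy
      obtain ⟨b, hb⟩ := hz
      exact ⟨a + b, by rw [map_add, add_mul, ha, hb, add_smul]⟩
    | mul y z _ _ hy hz =>
      obtain ⟨a, ha⟩ := hy
      obtain ⟨b, hb⟩ := hz
      exact ⟨b * a, by rw [map_mul, mul_assoc, hb, mul_smul_comm, ha, smul_smul]⟩
  · change φ _ * φ _ = 0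
    rw [hx]
    rw [symmetrizer_mul n hT, hq, zero_smul]
namespace MirabolicHecke

/-- The idempotent `q⁻¹ (q - 1 - T_0)` and the generators `T_1, …, T_{n-1}`, extended by zero. -/
def gen (q : ℂ) (n i : ℕ) : MirabolicHecke ℂ q n :=
  if h : i < n then if i = 0 then q⁻¹ • ((q - 1) • 1 - T ⟨i, h⟩) else T ⟨i, h⟩ else 0

variable {q : ℂ} {n : ℕ}

theorem gen_zero (h : 0 < n) : gen q n 0 = q⁻¹ • ((q - 1) • 1 - T ⟨0, h⟩) := by simp [gen, h]

theorem gen_of_pos {i : ℕ} (h0 : 1 ≤ i) (h : i < n) : gen q n i = T ⟨i, h⟩ := by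
  simp [gen, h, Nat.one_le_iff_ne_zero.1 h0]

theorem adjoin_gen (hq : q ≠ 0) : Algebra.adjoin ℂ (gen q n '' Set.Iio n) = ⊤ := by
  have h : Algebra.adjoin ℂ (Set.range (T : Fin n → MirabolicHecke ℂ q n)) = ⊤ := by
    have : Set.range (T : Fin n → MirabolicHecke ℂ q n) =
        RingQuot.mkAlgHom ℂ (SolomonRel ℂ q n) '' Set.range (FreeAlgebra.ι ℂ) := by
      rw [← Set.range_comp]; rfl
    rw [this, ← AlgHom.map_adjoin, FreeAlgebra.adjoin_range_ι, Algebra.map_top,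
      AlgHom.range_eq_top]
    exact RingQuot.mkAlgHom_surjective _ _
  rw [← top_le_iff, ← h, Algebra.adjoin_le_iff]
  rintro _ ⟨⟨i, hi⟩, rfl⟩
  have hg : gen q n i ∈ Algebra.adjoin ℂ (gen q n '' Set.Iio n) :=
    Algebra.subset_adjoin ⟨i, hi, rfl⟩
  rcases Nat.eq_zero_or_pos i with rfl | hi0
  · have e : (T ⟨0, hi⟩ : MirabolicHecke ℂ q n) = (q - 1) • 1 - q • gen q n 0 := by
      rw [gen_zero hi, smul_smul, mul_inv_cancel₀ hq, one_smul, sub_sub_cancel]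
    rw [e]
    exact sub_mem (Subalgebra.smul_mem _ (one_mem _) _) (Subalgebra.smul_mem _ hg _)
  · rwa [gen_of_pos hi0 hi] at hg

theorem heckeRel_gen : HeckeRel q n (gen q n) := by
  refine ⟨fun i h1 h2 => ?_, fun i h1 h2 => ?_, fun i j h1 h2 h3 => ?_⟩
  · rw [gen_of_pos h1 h2]
    simpa [T] using RingQuot.mkAlgHom_rel ℂ (SolomonRel.quad (K := ℂ) (q := q) ⟨i, h2⟩ h1)
  · rw [gen_of_pos h1 (by omega), gen_of_pos le_add_self h2]
    simpa [T] using RingQuot.mkAlgHom_rel ℂ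
      (SolomonRel.braid (K := ℂ) (q := q) ⟨i, by omega⟩ ⟨i + 1, h2⟩ h1 rfl)
  · rw [gen_of_pos h1 (by omega), gen_of_pos (by omega) h3]
    simpa [T] using RingQuot.mkAlgHom_rel ℂ
      (SolomonRel.comm (K := ℂ) (q := q) ⟨i, by omega⟩ ⟨j, h3⟩ (Or.inl h2))

theorem mirabolicRel_gen (hq : q ≠ 0) : MirabolicRel q n (gen q n) := by
  refine ⟨heckeRel_gen, fun hn => ?_, fun i h1 h2 => ?_, fun hn => ?_, fun hn => ?_⟩
  · rw [gen_zero hn]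
    have h : (T ⟨0, hn⟩ * T ⟨0, hn⟩ : MirabolicHecke ℂ q n) =
        (q - 2) • T ⟨0, hn⟩ + (q - 1) • 1 := by
      simpa [T] using RingQuot.mkAlgHom_rel ℂ (SolomonRel.quad0 (K := ℂ) (q := q) ⟨0, hn⟩ rfl)
    rw [smul_mul_smul_comm, sub_mul, mul_sub, mul_sub, h]
    simp only [smul_mul_assoc, mul_smul_comm, one_mul, mul_one]
    match_scalars <;> field_simp <;> ring
  · rw [gen_zero (by omega), gen_of_pos (by omega) h2]
    have h : Commute (T ⟨i, h2⟩ : MirabolicHecke ℂ q n) (T ⟨0, by omega⟩) := by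
      have := RingQuot.mkAlgHom_rel ℂ
        (SolomonRel.comm (K := ℂ) (q := q) ⟨i, h2⟩ ⟨0, by omega⟩ (Or.inr (by simpa using h1)))
      rwa [map_mul, map_mul] at this
    exact (((Commute.one_right _).smul_right _).sub_right h).smul_right _
  · have h := heckeRel_gen (q := q).quad 1 le_rfl hn
    rw [gen_zero (by omega)]
    rw [gen_of_pos le_rfl hn] at *
    have h4 := RingQuot.mkAlgHom_rel ℂ
      (SolomonRel.rel4 (K := ℂ) (q := q) ⟨0, by omega⟩ ⟨1, hn⟩ rfl rfl)
    simp only [map_mul, map_sub, map_add, map_smul] at h4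
    change T _ * T _ * T _ * T _ =
      (q - 1) • (T _ * T _ * T _ + T _ * T _) - T _ * T _ * T _ at h4
    generalize (T ⟨1, hn⟩ : MirabolicHecke ℂ q n) = t at *
    generalize (T ⟨0, _⟩ : MirabolicHecke ℂ q n) = s at *
    have h5 : s * t * t = s * ((q - 1) • t + q • 1) := by rw [mul_assoc, h]
    simp only [mul_add, mul_sub, sub_mul, mul_one, one_mul, smul_mul_assoc, mul_smul_comm] at *
    linear_combination (norm := (match_scalars <;> field_simp <;> ring))
      (q⁻¹ * q⁻¹) • h4 + (q⁻¹ * q⁻¹ * (q - 1) ^ 2) • h - (q⁻¹ * q⁻¹ * (q - 1)) • h5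
  · have h := heckeRel_gen (q := q).quad 1 le_rfl hn
    rw [gen_zero (by omega)]
    rw [gen_of_pos le_rfl hn] at *
    have h4 := RingQuot.mkAlgHom_rel ℂ
      (SolomonRel.rel5 (K := ℂ) (q := q) ⟨0, by omega⟩ ⟨1, hn⟩ rfl rfl)
    simp only [map_mul, map_sub, map_add, map_smul] at h4
    change T _ * T _ * T _ * T _ =
      (q - 1) • (T _ * T _ * T _ + T _ * T _) - T _ * T _ * T _ at h4
    generalize (T ⟨1, hn⟩ : MirabolicHecke ℂ q n) = t at *
    generalize (T ⟨0, _⟩ : MirabolicHecke ℂ q n) = s at *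
    have h5 : t * t * s = ((q - 1) • t + q • 1) * s := by rw [h]
    simp only [add_mul, mul_sub, sub_mul, mul_one, one_mul, smul_mul_assoc, mul_smul_comm,
      ← mul_assoc] at *
    linear_combination (norm := (match_scalars <;> field_simp <;> ring))
      (q⁻¹ * q⁻¹) • h4 + (q⁻¹ * q⁻¹ * (q - 1) ^ 2) • h - (q⁻¹ * q⁻¹ * (q - 1)) • h5

theorem exists_algHom_heckeOp (q : ℂ) (n : ℕ) :
    ∃ φ : MirabolicHecke ℂ q n →ₐ[ℂ] Module.End ℂ (Equiv.Perm ℕ →₀ ℂ),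
      ∀ i : Fin n, φ (T i) = if i.val = 0 then (q - 1) • 1 else heckeOp q i := by
  have hH := heckeRel_heckeOp q n
  let f : FreeAlgebra ℂ (Fin n) →ₐ[ℂ] Module.End ℂ (Equiv.Perm ℕ →₀ ℂ) :=
    FreeAlgebra.lift ℂ fun i => if i.val = 0 then (q - 1) • 1 else heckeOp q i
  have hf : ∀ i, f (FreeAlgebra.ι ℂ i) = if i.val = 0 then (q - 1) • 1 else heckeOp q i :=
    fun i => FreeAlgebra.lift_ι_apply _ _
  have hf0 : ∀ i : Fin n, i.val = 0 → f (FreeAlgebra.ι ℂ i) = (q - 1) • 1 := fun i hi => by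
    rw [hf, if_pos hi]
  have hf1 : ∀ i : Fin n, 1 ≤ i.val → f (FreeAlgebra.ι ℂ i) = heckeOp q i := fun i hi => by
    rw [hf, if_neg (by omega)]
  have hrel : ∀ ⦃x y⦄, SolomonRel ℂ q n x y → f x = f y := by
    intro x y hxy
    cases hxy with
    | quad0 i hi =>
      simp only [map_mul, map_add, map_smul, map_one, hf0 i hi, smul_mul_smul_comm, mul_one]
      module
    | quad i hi =>
      simpa only [map_mul, map_add, map_smul, map_one, hf1 i hi] using hH.quad i hi i.2
    | braid i j hi hij =>
      have := hH.braid i hi (by omega)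
      simpa only [map_mul, hf1 i hi, hf1 j (by omega), ← hij] using this
    | rel4 i j hi hj =>
      simp only [map_mul, map_add, map_sub, map_smul, hf0 i hi, smul_mul_assoc, mul_smul_comm,
        one_mul, mul_one]
      module
    | rel5 i j hi hj =>
      simp only [map_mul, map_add, map_sub, map_smul, hf0 i hi, smul_mul_assoc, mul_smul_comm,
        one_mul, mul_one]
      module
    | comm i j hij =>
      rw [map_mul, map_mul]
      rcases Nat.eq_zero_or_pos i.val with hi | hi
      · rw [hf0 i hi, smul_mul_assoc, mul_smul_comm, one_mul, mul_one]
      rcases Nat.eq_zero_or_pos j.val with hj | hj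
      · rw [hf0 j hj, smul_mul_assoc, mul_smul_comm, one_mul, mul_one]
      rw [hf1 i hi, hf1 j hj]
      rcases hij with hij | hij
      · exact hH.comm i j hi hij j.2
      · exact (hH.comm j i hj hij i.2).symm
  refine ⟨RingQuot.liftAlgHom ℂ ⟨f, hrel⟩, fun i => ?_⟩
  rw [T, RingQuot.liftAlgHom_mkAlgHom_apply, hf]

end MirabolicHecke

/-- For `q ∈ ℂ`, `q ≠ 0`, the specialized mirabolic Hecke algebra
`ℛ_n(q) = R_n(ℂ,q)` is a semisimple ring if and only if
`[n]_q! = ∏_{k=1}^{n} (1 + q + ⋯ + q^{k−1}) ≠ 0`. -/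
theorem mirabolicHecke_isSemisimple_iff (n : ℕ) (q : ℂ) (hq : q ≠ 0) :
    IsSemisimpleRing (MirabolicHecke ℂ q n) ↔
      (∏ k ∈ Finset.Icc 1 n, ∑ j ∈ Finset.range k, q ^ j) ≠ 0 := by
  constructor
  · intro hR h0
    obtain ⟨φ, hφ⟩ := MirabolicHecke.exists_algHom_heckeOp q n
    refine not_isSemisimpleRing_of_map_heckeOp (MirabolicHecke.adjoin_gen hq) φ ?_
      (fun i h1 h2 => ?_) h0 hR
    · rcases Nat.eq_zero_or_pos n with rfl | hn
      · simp [MirabolicHecke.gen]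
      · rw [MirabolicHecke.gen_zero hn, map_smul, map_sub, map_smul, map_one, hφ, if_pos rfl,
          sub_self, smul_zero]
    · rw [MirabolicHecke.gen_of_pos h1 h2, hφ, if_neg (Nat.one_le_iff_ne_zero.1 h1)]
  · intro h
    exact MirabolicRel.isSemisimpleRing hq n
      (fun k h1 h2 => Finset.prod_ne_zero_iff.1 h k (Finset.mem_Icc.2 ⟨h1, h2⟩))
      (MirabolicHecke.mirabolicRel_gen hq) (MirabolicHecke.adjoin_gen hq)
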